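/- There exist positive constants M, C, C̃, C' (depending only on d, R, λmin, λmax) such that for all Borel probability measures P, P' on ℝ^d supported in B̄(0,R) and all Σ, Σ' ∈ S, one has ‖p_{P,Σ} − p_{P',Σ'}‖₁ ≥ C' · (E_W + E_Σ), where E_W := exp( − (C / W₁(P,P')²) · exp( C̃ / W₁(P,P')² ) ) if W₁(P,P') > 0 and E_W := 0 otherwise, and E_Σ := exp( − M · log(1/‖Σ−Σ'‖_op) / ‖Σ−Σ'‖_op ) if Σ ≠ Σ' and E_Σ := 0 otherwise. -/

import Mathlib

open MeasureTheory Metric Real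

noncomputable section

abbrev Euc (d : ℕ) : Type := EuclideanSpace ℝ (Fin d)

noncomputable def opNorm {d : ℕ} (A : Matrix (Fin d) (Fin d) ℝ) : ℝ :=
  ‖LinearMap.toContinuousLinearMap (Matrix.toEuclideanLin A)‖

def quadForm {d : ℕ} (A : Matrix (Fin d) (Fin d) ℝ) (x : Euc d) : ℝ :=
  ∑ i, ∑ j, x i * A i j * x j

def matSet (d : ℕ) (lmin lmax : ℝ) : Set (Matrix (Fin d) (Fin d) ℝ) :=
  {A | A.IsSymm ∧ ∀ v : Euc d, lmin * ‖v‖ ^ 2 ≤ quadForm A v ∧ quadForm A v ≤ lmax * ‖v‖ ^ 2}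

noncomputable def W1 {d : ℕ} (P P' : Measure (Euc d)) : ℝ :=
  sSup {r | ∃ h : Euc d → ℝ, LipschitzWith 1 h ∧ r = (∫ x, h x ∂P) - ∫ x, h x ∂P'}

/-- The multivariate Gaussian kernel `f(x | θ, Σ)`. -/
noncomputable def gaussKer {d : ℕ} (A : Matrix (Fin d) (Fin d) ℝ) (θ x : Euc d) : ℝ :=
  (2 * π) ^ (-(d : ℝ) / 2) * (Real.sqrt A.det)⁻¹ *
    Real.exp (-(quadForm A⁻¹ (x - θ)) / 2)

/-- Gaussian mixture density. -/
noncomputable def gaussMix {d : ℕ} (P : Measure (Euc d)) (A : Matrix (Fin d) (Fin d) ℝ) :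
    Euc d → ℝ :=
  fun x => ∫ θ, gaussKer A θ x ∂P

lemma quadForm_eq_dot {d : ℕ} (A : Matrix (Fin d) (Fin d) ℝ) (x : Euc d) :
    quadForm A x = x.ofLp ⬝ᵥ (A.mulVec x.ofLp) := by
  simp [quadForm, dotProduct, Matrix.mulVec, Finset.mul_sum, mul_assoc]

lemma quadForm_one {d : ℕ} (x : Euc d) : quadForm (1 : Matrix (Fin d) (Fin d) ℝ) x = ‖x‖ ^ 2 := by
  rw [quadForm_eq_dot, Matrix.one_mulVec, EuclideanSpace.norm_sq_eq]
  simp [dotProduct, sq]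

lemma quadForm_comp {d : ℕ} (A S : Matrix (Fin d) (Fin d) ℝ) (x : Euc d) :
    quadForm A (Matrix.toEuclideanLin S x) = quadForm (S.transpose * A * S) x := by
  rw [quadForm_eq_dot, quadForm_eq_dot]
  simp only [Matrix.toLpLin_apply]
  rw [← Matrix.mulVec_mulVec, ← Matrix.mulVec_mulVec, Matrix.dotProduct_mulVec x.ofLp S.transpose,
    Matrix.vecMul_transpose]

lemma quadForm_smul {d : ℕ} (A : Matrix (Fin d) (Fin d) ℝ) (c : ℝ) (x : Euc d) :
    quadForm A (c • x) = c ^ 2 * quadForm A x := by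
  simp [quadForm, Finset.mul_sum]
  refine Finset.sum_congr rfl fun i _ => Finset.sum_congr rfl fun j _ => by ring

lemma continuous_quadForm {d : ℕ} (A : Matrix (Fin d) (Fin d) ℝ) : Continuous (quadForm A) := by
  unfold quadForm; fun_prop

lemma matSet_posDef {d : ℕ} {l L : ℝ} (hl : 0 < l) {A : Matrix (Fin d) (Fin d) ℝ}
    (hA : A ∈ matSet d l L) : A.PosDef := by
  refine Matrix.PosDef.of_dotProduct_mulVec_pos ?_ ?_
  · simpa [Matrix.IsHermitian, Matrix.IsSymm] using hA.1
  · intro x hx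
    have h := (hA.2 (WithLp.toLp 2 x)).1
    rw [quadForm_eq_dot] at h
    have : 0 < ‖(WithLp.toLp 2 x : Euc d)‖ := by
      rw [norm_pos_iff]; intro h0; apply hx; simpa using h0
    have : 0 < l * ‖(WithLp.toLp 2 x : Euc d)‖ ^ 2 := by positivity
    simpa using this.trans_le h

open scoped MatrixOrder Matrix.Norms.L2Operator in
lemma exists_sqrt_mat {d : ℕ} {A : Matrix (Fin d) (Fin d) ℝ} (hA : A.PosDef) :
    ∃ S : Matrix (Fin d) (Fin d) ℝ, S.transpose = S ∧ S * S = A := by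
  have h0 : 0 ≤ A := Matrix.nonneg_iff_posSemidef.2 hA.posSemidef
  refine ⟨CFC.sqrt A, ?_, CFC.sqrt_mul_sqrt_self A h0⟩
  have := (Matrix.nonneg_iff_posSemidef.1 (CFC.sqrt_nonneg A)).isHermitian
  simpa [Matrix.IsHermitian] using this

lemma integral_comp_mat {d : ℕ} {S : Matrix (Fin d) (Fin d) ℝ} (hS : S.det ≠ 0)
    (f : Euc d → ℂ) :
    ∫ x, f x = |S.det| • ∫ y, f (Matrix.toEuclideanLin S y) := by
  have hdet : LinearMap.det (Matrix.toEuclideanLin S) = S.det := by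
    rw [Matrix.toEuclideanLin_eq_toLin_orthonormal, LinearMap.det_toLin]
  have hdet' : LinearMap.det (Matrix.toEuclideanLin S) ≠ 0 := by rwa [hdet]
  have h := Measure.map_linearMap_addHaar_eq_smul_addHaar (volume : Measure (Euc d)) hdet'
  have hemb : MeasurableEmbedding (Matrix.toEuclideanLin S) := by
    have := ((Matrix.toEuclideanLin S).equivOfDetNeZero hdet').toContinuousLinearEquiv.toHomeomorph.measurableEmbedding
    exact this
  rw [← hemb.integral_map (μ := volume) f, h, integral_smul_measure, hdet]
  rw [ENNReal.toReal_ofReal (abs_nonneg _), smul_smul, ← abs_mul, mul_inv_cancel₀ hS, abs_one, one_smul]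

lemma integrable_comp_mat {d : ℕ} {S : Matrix (Fin d) (Fin d) ℝ} (hS : S.det ≠ 0)
    (f : Euc d → ℂ) (hf : Integrable (fun y => f (Matrix.toEuclideanLin S y))) :
    Integrable f := by
  have hdet : LinearMap.det (Matrix.toEuclideanLin S) = S.det := by
    rw [Matrix.toEuclideanLin_eq_toLin_orthonormal, LinearMap.det_toLin]
  have hdet' : LinearMap.det (Matrix.toEuclideanLin S) ≠ 0 := by rwa [hdet]
  have h := Measure.map_linearMap_addHaar_eq_smul_addHaar (volume : Measure (Euc d)) hdet'
  have hemb : MeasurableEmbedding (Matrix.toEuclideanLin S) := by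
    have := ((Matrix.toEuclideanLin S).equivOfDetNeZero hdet').toContinuousLinearEquiv.toHomeomorph.measurableEmbedding
    exact this
  have h2 := (hemb.integrable_map_iff (μ := volume) (g := f)).2 hf
  rw [h] at h2
  refine (integrable_smul_measure ?_ ?_).1 h2
  · simp [hdet, hS]
  · simp

lemma gauss_fourier {d : ℕ} {A : Matrix (Fin d) (Fin d) ℝ} (hA : A.PosDef) (t : Euc d) :
    Integrable (fun x : Euc d => (gaussKer A 0 x : ℂ) * Complex.exp (inner ℝ x t * Complex.I)) ∧
    ∫ x : Euc d, (gaussKer A 0 x : ℂ) * Complex.exp (inner ℝ x t * Complex.I)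
      = Complex.exp (-(quadForm A t) / 2) := by
  obtain ⟨S, hST, hSS⟩ := exists_sqrt_mat hA
  have hdetA : A.det = S.det ^ 2 := by rw [← hSS, Matrix.det_mul, sq]
  have hS : S.det ≠ 0 := by
    intro h; have := hA.det_pos; rw [hdetA, h] at this; simp at this
  have hSu : IsUnit S.det := isUnit_iff_ne_zero.2 hS
  have hq : S.transpose * A⁻¹ * S = 1 := by
    rw [hST, ← hSS, Matrix.mul_inv_rev, ← mul_assoc, Matrix.mul_nonsing_inv _ hSu, one_mul,
      Matrix.nonsing_inv_mul _ hSu]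
  have hpt : ∀ y : Euc d, (gaussKer A 0 (Matrix.toEuclideanLin S y) : ℂ) *
      Complex.exp (inner ℝ (Matrix.toEuclideanLin S y) t * Complex.I) =
      (((2 * π) ^ (-(d : ℝ) / 2) * |S.det|⁻¹ : ℝ) : ℂ) *
        Complex.exp (-(1/2 : ℂ) * ‖y‖ ^ 2 + Complex.I * inner ℝ (Matrix.toEuclideanLin S t) y) := by
    intro y
    have h1 : inner ℝ (Matrix.toEuclideanLin S y) t = inner ℝ (Matrix.toEuclideanLin S t) y := by
      simp only [EuclideanSpace.inner_eq_star_dotProduct, Matrix.toLpLin_apply, star_trivial]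
      rw [Matrix.dotProduct_mulVec, ← Matrix.mulVec_transpose, hST, dotProduct_comm]
    unfold gaussKer
    rw [sub_zero, quadForm_comp, hq, quadForm_one, hdetA, Real.sqrt_sq_eq_abs, h1, Complex.exp_add]
    push_cast
    rw [mul_assoc]
    congr 3 <;> ring
  have hre : 0 < (1/2 : ℂ).re := by norm_num
  constructor
  · apply integrable_comp_mat hS
    simp_rw [hpt]
    exact (GaussianFourier.integrable_cexp_neg_mul_sq_norm_add hre _ _).const_mul _
  · rw [integral_comp_mat hS]
    simp_rw [hpt]
    rw [integral_const_mul, GaussianFourier.integral_cexp_neg_mul_sq_norm_add hre]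
    have h3 : (‖Matrix.toEuclideanLin S t‖ : ℂ) ^ 2 = quadForm A t := by
      have : ‖Matrix.toEuclideanLin S t‖ ^ 2 = quadForm A t := by
        rw [← quadForm_one, quadForm_comp, mul_one, hST, hSS]
      exact_mod_cast this
    rw [h3, Complex.I_sq]
    have h4 : ((π : ℂ) / (1/2)) ^ ((Module.finrank ℝ (Euc d) : ℂ) / 2) = (((2 * π) ^ ((d : ℝ) / 2) : ℝ) : ℂ) := by
      rw [Complex.ofReal_cpow (by positivity)]
      simp
      ring_nf
    rw [h4, Complex.real_smul, ← mul_assoc, ← mul_assoc, ← Complex.ofReal_mul, ← Complex.ofReal_mul]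
    have h5 : |S.det| * ((2 * π) ^ (-(d : ℝ) / 2) * |S.det|⁻¹) * (2 * π) ^ ((d : ℝ) / 2) = 1 := by
      have : (2 * π) ^ (-(d : ℝ) / 2) * (2 * π) ^ ((d : ℝ) / 2) = 1 := by
        rw [← Real.rpow_add (by positivity)]; simp [neg_div]
      have h6 : |S.det| * |S.det|⁻¹ = 1 := mul_inv_cancel₀ (abs_ne_zero.2 hS)
      linear_combination (|S.det| * |S.det|⁻¹) * this + h6
    rw [h5]
    simp
    ring_nf

lemma gaussKer_shift {d : ℕ} (A : Matrix (Fin d) (Fin d) ℝ) (θ x : Euc d) :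
    gaussKer A θ x = gaussKer A 0 (x - θ) := by simp [gaussKer]

lemma gaussKer_nonneg {d : ℕ} (A : Matrix (Fin d) (Fin d) ℝ) (θ x : Euc d) :
    0 ≤ gaussKer A θ x := by unfold gaussKer; positivity

lemma continuous_gaussKer {d : ℕ} (A : Matrix (Fin d) (Fin d) ℝ) :
    Continuous (fun p : Euc d × Euc d => gaussKer A p.1 p.2) := by
  unfold gaussKer
  have := continuous_quadForm A⁻¹
  fun_prop

lemma gauss_fourier' {d : ℕ} {A : Matrix (Fin d) (Fin d) ℝ} (hA : A.PosDef) (θ t : Euc d) :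
    Integrable (fun x : Euc d => (gaussKer A θ x : ℂ) * Complex.exp (inner ℝ x t * Complex.I)) ∧
    ∫ x : Euc d, (gaussKer A θ x : ℂ) * Complex.exp (inner ℝ x t * Complex.I)
      = Complex.exp (inner ℝ θ t * Complex.I) * Complex.exp (-(quadForm A t) / 2) := by
  have h := gauss_fourier hA t
  have hpt : (fun x : Euc d => (gaussKer A θ x : ℂ) * Complex.exp (inner ℝ x t * Complex.I)) =
      fun x => Complex.exp (inner ℝ θ t * Complex.I) * ((fun x => (gaussKer A 0 x : ℂ) * Complex.exp (inner ℝ x t * Complex.I)) (x - θ)) := by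
    funext x
    rw [gaussKer_shift]
    simp only [inner_sub_left, Complex.ofReal_sub, sub_mul, Complex.exp_sub]
    field_simp
  rw [hpt]
  refine ⟨(h.1.comp_sub_right θ).const_mul _, ?_⟩
  rw [integral_const_mul, integral_sub_right_eq_self (fun x : Euc d => (gaussKer A 0 x : ℂ) * Complex.exp (inner ℝ x t * Complex.I)), h.2]

lemma gaussKer_integral {d : ℕ} {A : Matrix (Fin d) (Fin d) ℝ} (hA : A.PosDef) (θ : Euc d) :
    Integrable (gaussKer A θ) ∧ ∫ x, gaussKer A θ x = 1 := by
  have h := gauss_fourier' hA θ 0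
  simp [quadForm] at h
  exact ⟨by simpa using h.1.re, by exact_mod_cast h.2⟩

lemma integrable_prod_ker {d : ℕ} {A : Matrix (Fin d) (Fin d) ℝ} (hA : A.PosDef)
    (P : Measure (Euc d)) [IsProbabilityMeasure P] :
    Integrable (fun p : Euc d × Euc d => gaussKer A p.1 p.2) (P.prod volume) := by
  rw [integrable_prod_iff (continuous_gaussKer A).aestronglyMeasurable]
  refine ⟨Filter.Eventually.of_forall fun θ => (gaussKer_integral hA θ).1, ?_⟩
  have : (fun x => ∫ y, ‖gaussKer A x y‖) = fun _ : Euc d => (1 : ℝ) := by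
    funext x
    simp_rw [Real.norm_of_nonneg (gaussKer_nonneg A _ _)]
    exact (gaussKer_integral hA x).2
  simp only [this]
  exact integrable_const _

lemma integrable_gaussMix {d : ℕ} {A : Matrix (Fin d) (Fin d) ℝ} (hA : A.PosDef)
    (P : Measure (Euc d)) [IsProbabilityMeasure P] : Integrable (gaussMix P A) :=
  (integrable_prod_ker hA P).integral_prod_right

lemma gaussMix_fourier {d : ℕ} {A : Matrix (Fin d) (Fin d) ℝ} (hA : A.PosDef)
    (P : Measure (Euc d)) [IsProbabilityMeasure P] (t : Euc d) :
    ∫ x : Euc d, (gaussMix P A x : ℂ) * Complex.exp (inner ℝ x t * Complex.I)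
      = charFun P t * Complex.exp (-(quadForm A t) / 2) := by
  have hInteg : Integrable (fun p : Euc d × Euc d => (gaussKer A p.1 p.2 : ℂ) * Complex.exp (inner ℝ p.2 t * Complex.I)) (P.prod volume) := by
    refine (integrable_prod_ker hA P).ofReal.mul_bdd (c := 1) ?_ ?_
    · exact Continuous.aestronglyMeasurable (by fun_prop)
    · exact Filter.Eventually.of_forall fun p => by rw [Complex.norm_exp_ofReal_mul_I]
  have h1 : ∀ x : Euc d, (gaussMix P A x : ℂ) * Complex.exp (inner ℝ x t * Complex.I) =
      ∫ θ, (gaussKer A θ x : ℂ) * Complex.exp (inner ℝ x t * Complex.I) ∂P := by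
    intro x
    rw [integral_mul_const, integral_complex_ofReal]; rfl
  simp_rw [h1]
  rw [← integral_integral_swap (μ := P) (ν := volume)
    (f := fun θ x => (gaussKer A θ x : ℂ) * Complex.exp (inner ℝ x t * Complex.I)) hInteg]
  simp_rw [(gauss_fourier' hA _ t).2]
  rw [integral_mul_const, charFun_apply]

/-- basic comparison of characteristic functions -/
lemma char_le_V {d : ℕ} {A B : Matrix (Fin d) (Fin d) ℝ} (hA : A.PosDef) (hB : B.PosDef)
    (P P' : Measure (Euc d)) [IsProbabilityMeasure P] [IsProbabilityMeasure P'] (t : Euc d) :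
    ‖charFun P t * Complex.exp (-(quadForm A t) / 2) - charFun P' t * Complex.exp (-(quadForm B t) / 2)‖
      ≤ ∫ x, |gaussMix P A x - gaussMix P' B x| := by
  have hi : ∀ {A : Matrix (Fin d) (Fin d) ℝ} (hA : A.PosDef) (P : Measure (Euc d)) [IsProbabilityMeasure P],
      Integrable (fun x : Euc d => (gaussMix P A x : ℂ) * Complex.exp (inner ℝ x t * Complex.I)) := by
    intro A hA P _
    refine (integrable_gaussMix hA P).ofReal.mul_bdd (c := 1) ?_ ?_
    · exact Continuous.aestronglyMeasurable (by fun_prop)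
    · exact Filter.Eventually.of_forall fun p => by rw [Complex.norm_exp_ofReal_mul_I]
  rw [← gaussMix_fourier hA, ← gaussMix_fourier hB, ← integral_sub (hi hA P) (hi hB P')]
  refine (norm_integral_le_integral_norm _).trans (le_of_eq ?_)
  congr 1
  funext x
  rw [← sub_mul, norm_mul, Complex.norm_exp_ofReal_mul_I, mul_one, ← Complex.ofReal_sub,
    Complex.norm_real, Real.norm_eq_abs]

def trigCoef (k m : ℕ) : ℂ := (-1) ^ (k + m) * ((2 * k).choose m : ℂ)

lemma trigCoef_norm_sum (k : ℕ) : ∑ m ∈ Finset.range (2 * k + 1), ‖trigCoef k m‖ = 4 ^ k := by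
  have : ∀ m, ‖trigCoef k m‖ = ((2 * k).choose m : ℝ) := by
    intro m; simp [trigCoef]
  simp_rw [this]
  have h := Nat.sum_range_choose (2 * k)
  rw [pow_mul] at h
  exact_mod_cast h

lemma trig_expand (k : ℕ) (u : ℝ) : (((2 - 2 * Real.cos u) ^ k : ℝ) : ℂ) =
    ∑ m ∈ Finset.range (2 * k + 1), trigCoef k m * Complex.exp ((((m : ℝ) - k) * u : ℝ) * Complex.I) := by
  set E := Complex.exp (u * Complex.I) with hE
  have hE0 : E ≠ 0 := Complex.exp_ne_zero _
  have h1 : ((2 - 2 * Real.cos u : ℝ) : ℂ) = - E⁻¹ * (-E + 1) ^ 2 := by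
    have h2 : 2 * (Real.cos u : ℂ) = E + E⁻¹ := by
      rw [hE, ← Complex.exp_neg, Complex.ofReal_cos, Complex.two_cos, neg_mul]
    push_cast at h2 ⊢
    rw [h2]; field_simp; ring
  rw [Complex.ofReal_pow, h1, mul_pow, ← pow_mul, add_pow, Finset.mul_sum]
  refine Finset.sum_congr rfl fun m _ => ?_
  have h3 : Complex.exp ((((m : ℝ) - k) * u : ℝ) * Complex.I) = E ^ m * (E⁻¹) ^ k := by
    rw [hE, ← Complex.exp_neg, ← Complex.exp_nat_mul, ← Complex.exp_nat_mul, ← Complex.exp_add]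
    congr 1; push_cast; ring
  rw [h3, trigCoef, neg_pow E⁻¹, neg_pow E, pow_add]
  simp
  ring

lemma gauss_trig_lower {R s h : ℝ} (hR : 0 < R) (hs : 0 < s) (hh : 0 < h) (hRh : 6 * R * h ≤ 3)
    (k : ℕ) {x : ℝ} (hx : |x| ≤ R) :
    (4 * (h ^ 2 * R ^ 2)) ^ k * (R * ((√(2 * π * s))⁻¹ * Real.exp (-(49 * R ^ 2 / (2 * s))))) ≤
    ∫ y, (2 - 2 * Real.cos (h * y)) ^ k ∂(ProbabilityTheory.gaussianReal x s.toNNReal) := by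
  have hs' : s.toNNReal ≠ 0 := by simpa using hs
  rw [ProbabilityTheory.integral_gaussianReal_eq_integral_smul hs']
  have hG0 : ∀ y, 0 ≤ (2 - 2 * Real.cos (h * y)) ^ k := fun y => by
    have := Real.cos_le_one (h * y)
    exact pow_nonneg (by linarith) _
  have hcont : Continuous fun y => (2 - 2 * Real.cos (h * y)) ^ k := by fun_prop
  have hInteg : Integrable (fun y => ProbabilityTheory.gaussianPDFReal x s.toNNReal y • (2 - 2 * Real.cos (h * y)) ^ k) := by
    refine (ProbabilityTheory.integrable_gaussianPDFReal x _).mul_bdd (c := 4 ^ k) hcont.aestronglyMeasurable ?_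
    refine Filter.Eventually.of_forall fun y => ?_
    rw [Real.norm_of_nonneg (hG0 y)]
    have := Real.cos_le_one (h * y)
    have := Real.neg_one_le_cos (h * y)
    exact pow_le_pow_left₀ (by linarith) (by linarith) _
  have hnn : ∀ y, 0 ≤ ProbabilityTheory.gaussianPDFReal x s.toNNReal y • (2 - 2 * Real.cos (h * y)) ^ k :=
    fun y => mul_nonneg (ProbabilityTheory.gaussianPDFReal_nonneg _ _ _) (hG0 y)
  refine le_trans ?_ (setIntegral_le_integral (s := Set.Icc (5 * R) (6 * R)) hInteg (Filter.Eventually.of_forall hnn))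
  have hc : (4 * (h ^ 2 * R ^ 2)) ^ k * (R * ((√(2 * π * s))⁻¹ * Real.exp (-(49 * R ^ 2 / (2 * s))))) =
    ∫ y in Set.Icc (5 * R) (6 * R), (4 * (h ^ 2 * R ^ 2)) ^ k * ((√(2 * π * s))⁻¹ * Real.exp (-(49 * R ^ 2 / (2 * s)))) := by
    rw [setIntegral_const, smul_eq_mul, Measure.real, Real.volume_Icc, ENNReal.toReal_ofReal (by linarith)]
    ring
  rw [hc]
  refine setIntegral_mono_on (integrableOn_const (by simp)) hInteg.integrableOn measurableSet_Icc ?_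
  rintro y ⟨hy1, hy2⟩
  rw [smul_eq_mul, mul_comm]
  have hy0 : 0 ≤ y := by linarith
  have hx' := abs_le.1 hx
  refine mul_le_mul ?_ (pow_le_pow_left₀ (by positivity) ?_ _) (by positivity) (ProbabilityTheory.gaussianPDFReal_nonneg _ _ _)
  · rw [ProbabilityTheory.gaussianPDFReal_def]
    simp only [Real.coe_toNNReal s hs.le]
    gcongr
    rw [neg_div]
    gcongr
    nlinarith
  · have hb : |h * y| ≤ π := by
      rw [abs_of_nonneg (by positivity)]
      nlinarith [Real.pi_gt_three]
    have := Real.cos_le_one_sub_mul_cos_sq hb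
    have hpi : 2 / π ^ 2 ≥ 1 / 8 := by
      rw [ge_iff_le, div_le_div_iff₀ (by norm_num) (by positivity)]
      nlinarith [Real.pi_lt_four, Real.pi_pos]
    have h4 : 1 / 8 * (h * y) ^ 2 ≤ 2 / π ^ 2 * (h * y) ^ 2 := by gcongr
    have h5 : h ^ 2 * (25 * R ^ 2) ≤ h ^ 2 * y ^ 2 := by
      gcongr; nlinarith
    nlinarith [sq_nonneg (h * R)]

lemma gauss_trig_eq {s h : ℝ} (hs : 0 < s) (k : ℕ) (x : ℝ) :
    ((∫ y, (2 - 2 * Real.cos (h * y)) ^ k ∂(ProbabilityTheory.gaussianReal x s.toNNReal) : ℝ) : ℂ) =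
    ∑ m ∈ Finset.range (2 * k + 1), trigCoef k m *
      (Complex.exp (-(s * (((m : ℝ) - k) * h) ^ 2) / 2) * Complex.exp ((((m : ℝ) - k) * h * x : ℝ) * Complex.I)) := by
  rw [← integral_complex_ofReal]
  simp_rw [trig_expand]
  rw [integral_finsetSum]
  · refine Finset.sum_congr rfl fun m _ => ?_
    rw [integral_const_mul]
    congr 1
    have := ProbabilityTheory.charFun_gaussianReal (μ := x) (v := s.toNNReal) (((m : ℝ) - k) * h)
    rw [charFun_apply_real] at this
    rw [← Complex.exp_add]
    rw [Real.coe_toNNReal s hs.le] at this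
    have e1 : ∀ y : ℝ, (((((m : ℝ) - k) * (h * y) : ℝ) : ℂ) * Complex.I) =
        (((((m : ℝ) - k) * h : ℝ) : ℂ) * y * Complex.I) := by
      intro y; push_cast; ring
    simp_rw [e1]
    rw [this]
    congr 1
    push_cast; ring
  · intro m _
    refine Integrable.const_mul ?_ _
    refine Integrable.of_bound (C := 1) (Continuous.aestronglyMeasurable (by fun_prop)) ?_
    exact Filter.Eventually.of_forall fun p => by rw [Complex.norm_exp_ofReal_mul_I]

lemma charFun_smul_eq {d : ℕ} (P : Measure (Euc d)) (v : Euc d) (τ : ℝ) :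
    charFun P (τ • v) = ∫ θ, Complex.exp ((τ * inner ℝ θ v : ℝ) * Complex.I) ∂P := by
  rw [charFun_apply]
  simp_rw [inner_smul_right]

lemma integral_trig_sum {d : ℕ} (P : Measure (Euc d)) [IsProbabilityMeasure P] (v : Euc d) (h : ℝ) (k : ℕ)
    (w : ℕ → ℂ) :
    ∫ θ, ∑ m ∈ Finset.range (2 * k + 1), trigCoef k m *
      (w m * Complex.exp ((((m : ℝ) - k) * h * inner ℝ θ v : ℝ) * Complex.I)) ∂P =
    ∑ m ∈ Finset.range (2 * k + 1), trigCoef k m * (w m * charFun P ((((m : ℝ) - k) * h) • v)) := by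
  rw [integral_finsetSum]
  · refine Finset.sum_congr rfl fun m _ => ?_
    rw [integral_const_mul, integral_const_mul, charFun_smul_eq]
  · intro m _
    refine (Integrable.const_mul ?_ _).const_mul _
    refine Integrable.of_bound (C := 1) (Continuous.aestronglyMeasurable (by fun_prop)) ?_
    exact Filter.Eventually.of_forall fun p => by rw [Complex.norm_exp_ofReal_mul_I]

lemma ae_ball {d : ℕ} {R : ℝ} {P : Measure (Euc d)} (hP : P (closedBall 0 R)ᶜ = 0) :
    ∀ᵐ θ ∂P, ‖θ‖ ≤ R := by
  have : ∀ᵐ θ ∂P, θ ∈ closedBall (0 : Euc d) R := hP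
  filter_upwards [this] with θ h
  simpa using h

lemma caseB {d : ℕ} {R L h : ℝ} (hR : 0 < R) {A B : Matrix (Fin d) (Fin d) ℝ}
    (hA : A.PosDef) (hB : B.PosDef)
    (P P' : Measure (Euc d)) [IsProbabilityMeasure P] [IsProbabilityMeasure P']
    (hP : P (closedBall 0 R)ᶜ = 0) (hP' : P' (closedBall 0 R)ᶜ = 0)
    (v : Euc d) (hv : ‖v‖ = 1) (hs : 0 < quadForm A v - quadForm B v) (hL : quadForm B v ≤ L)
    (hL0 : 0 ≤ L)
    (hh : 0 < h) (hRh : 6 * R * h ≤ 3) (k : ℕ)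
    (hk : 2 ≤ 4 ^ k * (R * ((√(2 * π * (quadForm A v - quadForm B v)))⁻¹ *
      Real.exp (-(49 * R ^ 2 / (2 * (quadForm A v - quadForm B v))))))) :
    (h ^ 2 * R ^ 2) ^ k ≤ (∫ x, |gaussMix P A x - gaussMix P' B x|) * (4 ^ k * Real.exp (L * (h * k) ^ 2 / 2)) := by
  set s := quadForm A v - quadForm B v with hsdef
  set V := ∫ x, |gaussMix P A x - gaussMix P' B x| with hV
  have hV0 : 0 ≤ V := integral_nonneg fun x => abs_nonneg _
  set q := (R * ((√(2 * π * s))⁻¹ * Real.exp (-(49 * R ^ 2 / (2 * s)))))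
  -- upper
  set Y : ℝ := ∫ θ, (2 - 2 * Real.cos (h * inner ℝ θ v)) ^ k ∂P' with hY
  set F : ℝ → ℝ := fun x => ∫ y, (2 - 2 * Real.cos (h * y)) ^ k ∂(ProbabilityTheory.gaussianReal x s.toNNReal) with hF
  set X : ℝ := ∫ θ, F (inner ℝ θ v) ∂P with hX
  have hinner : ∀ θ : Euc d, |inner ℝ θ v| ≤ ‖θ‖ := fun θ => by
    have := abs_real_inner_le_norm θ v
    rwa [hv, mul_one] at this
  have hG0 : ∀ y, 0 ≤ (2 - 2 * Real.cos y) := fun y => by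
    have := Real.cos_le_one y
    linarith
  have hG4 : ∀ y, (2 - 2 * Real.cos y) ≤ 4 := fun y => by
    have := Real.neg_one_le_cos y
    linarith
  have hYle : Y ≤ (h ^ 2 * R ^ 2) ^ k := by
    have : Y ≤ ∫ θ, (h ^ 2 * R ^ 2) ^ k ∂P' := by
      refine integral_mono_ae ?_ (integrable_const _) ?_
      · refine Integrable.of_bound (C := 4 ^ k) (Continuous.aestronglyMeasurable (by fun_prop)) ?_
        refine Filter.Eventually.of_forall fun θ => ?_
        rw [Real.norm_of_nonneg (pow_nonneg (hG0 _) _)]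
        exact pow_le_pow_left₀ (hG0 _) (hG4 _) _
      · filter_upwards [ae_ball hP'] with θ hθ
        refine pow_le_pow_left₀ (hG0 _) ?_ _
        have h1 := Real.one_sub_sq_div_two_le_cos (x := h * inner ℝ θ v)
        have h2 : (inner ℝ θ v) ^ 2 ≤ R ^ 2 := by
          rw [← sq_abs]; gcongr; exact (hinner θ).trans hθ
        have h3 : h ^ 2 * (inner ℝ θ v) ^ 2 ≤ h ^ 2 * R ^ 2 := by gcongr
        nlinarith
    simpa using this
  have hFc : ∀ x, ((F x : ℝ) : ℂ) = _ := fun x => gauss_trig_eq hs k x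
  have hXge : (4 * (h ^ 2 * R ^ 2)) ^ k * q ≤ X := by
    have : ∫ θ, (4 * (h ^ 2 * R ^ 2)) ^ k * q ∂P ≤ X := by
      refine integral_mono_ae (integrable_const _) ?_ ?_
      · have hi : Integrable (fun θ : Euc d => ((F (inner ℝ θ v) : ℝ) : ℂ)) P := by
          simp_rw [hFc]
          refine integrable_finsetSum _ fun m _ => ?_
          refine (Integrable.const_mul ?_ _).const_mul _
          refine Integrable.of_bound (C := 1) (Continuous.aestronglyMeasurable (by fun_prop)) ?_
          exact Filter.Eventually.of_forall fun p => by rw [Complex.norm_exp_ofReal_mul_I]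
        simpa using hi.re
      · filter_upwards [ae_ball hP] with θ hθ
        exact gauss_trig_lower hR hs hh hRh k ((hinner θ).trans hθ)
    simpa using this
  have hXc : (X : ℂ) = ∑ m ∈ Finset.range (2 * k + 1), trigCoef k m *
      (Complex.exp (-(s * (((m : ℝ) - k) * h) ^ 2) / 2) * charFun P ((((m : ℝ) - k) * h) • v)) := by
    rw [hX, ← integral_complex_ofReal]
    simp_rw [hFc]
    exact integral_trig_sum P v h k (fun m => Complex.exp (-(s * (((m : ℝ) - k) * h) ^ 2) / 2))
  have hYc : (Y : ℂ) = ∑ m ∈ Finset.range (2 * k + 1), trigCoef k m *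
      (1 * charFun P' ((((m : ℝ) - k) * h) • v)) := by
    rw [hY, ← integral_complex_ofReal]
    simp_rw [trig_expand]
    rw [← integral_trig_sum P' v h k (fun m => 1)]
    simp only [one_mul, mul_assoc]
  have hdiff : X - Y ≤ V * (4 ^ k * Real.exp (L * (h * k) ^ 2 / 2)) := by
    have h1 : X - Y ≤ ‖(X : ℂ) - Y‖ := by
      rw [← Complex.ofReal_sub, Complex.norm_real]; exact le_abs_self _
    refine h1.trans ?_
    rw [hXc, hYc, ← Finset.sum_sub_distrib, ← trigCoef_norm_sum k, Finset.sum_mul, Finset.mul_sum]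
    refine (norm_sum_le _ _).trans (Finset.sum_le_sum fun m hm => ?_)
    rw [← mul_sub, norm_mul]
    set τ : ℝ := ((m : ℝ) - k) * h with hτ
    have hc := char_le_V hA hB P P' (τ • v)
    rw [← hV, quadForm_smul, quadForm_smul] at hc
    have he : Complex.exp (-(s * (((m : ℝ) - k) * h) ^ 2) / 2) * charFun P (τ • v) - 1 * charFun P' (τ • v)
      = (Real.exp (τ ^ 2 * quadForm B v / 2) : ℂ) * (charFun P (τ • v) * Complex.exp (-((τ ^ 2 * quadForm A v : ℝ) : ℂ) / 2)
         - charFun P' (τ • v) * Complex.exp (-((τ ^ 2 * quadForm B v : ℝ) : ℂ) / 2)) := by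
      rw [mul_sub, mul_left_comm, mul_left_comm _ (charFun P' _), Complex.ofReal_exp, ← Complex.exp_add, ← Complex.exp_add,
        mul_comm (Complex.exp _), mul_comm (1 : ℂ)]
      congr 2
      · congr 1
        rw [hsdef, hτ]; push_cast; ring
      · rw [← Complex.exp_zero]; congr 1; push_cast; ring
    rw [he, norm_mul, Complex.norm_real, Real.norm_of_nonneg (Real.exp_pos _).le]
    have hexp : Real.exp (τ ^ 2 * quadForm B v / 2) ≤ Real.exp (L * (h * k) ^ 2 / 2) := by
      have hτ2 : τ ^ 2 ≤ (h * k) ^ 2 := by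
        apply sq_le_sq'
        · rw [hτ]; have : (0 : ℝ) ≤ m := by positivity
          nlinarith
        · rw [hτ]
          have : (m : ℝ) ≤ 2 * k := by
            have := Finset.mem_range.1 hm
            exact_mod_cast (by omega : m ≤ 2 * k)
          nlinarith
      refine Real.exp_le_exp.2 (div_le_div_of_nonneg_right ?_ (by norm_num))
      calc τ ^ 2 * quadForm B v ≤ τ ^ 2 * L := by gcongr
        _ ≤ (h * k) ^ 2 * L := by gcongr
        _ = _ := by ring
    calc _ ≤ ‖trigCoef k m‖ * (Real.exp (L * (h * k) ^ 2 / 2) * V) := by gcongr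
      _ = _ := by ring
  have h2 : 2 * (h ^ 2 * R ^ 2) ^ k ≤ X := by
    refine le_trans ?_ hXge
    rw [mul_pow 4 (h ^ 2 * R ^ 2) k]
    have : 0 ≤ (h ^ 2 * R ^ 2) ^ k := by positivity
    calc 2 * (h ^ 2 * R ^ 2) ^ k ≤ (4 ^ k * q) * (h ^ 2 * R ^ 2) ^ k := by gcongr
      _ = _ := by ring
  linarith

lemma lemma1_pos {d : ℕ} {R l L : ℝ} (hR : 0 < R) (hl : 0 < l) (hlL : l < L) :
    ∃ K0 K1 : ℝ, 0 < K0 ∧ 0 < K1 ∧ ∀ (P P' : Measure (Euc d)), IsProbabilityMeasure P → IsProbabilityMeasure P' →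
        P (closedBall 0 R)ᶜ = 0 → P' (closedBall 0 R)ᶜ = 0 →
        ∀ A ∈ matSet d l L, ∀ B ∈ matSet d l L, ∀ v : Euc d, ‖v‖ = 1 → 
        0 < quadForm A v - quadForm B v → ∀ k : ℕ, 1 ≤ k → K0 ≤ k * (quadForm A v - quadForm B v) →
        Real.exp (-(K1 * (k * Real.log (k + 1)))) ≤ ∫ x, |gaussMix P A x - gaussMix P' B x| := by
  have hL : 0 < L := hl.trans hlL
  set D := |Real.log (2 * √(2 * π * L) / R)| with hD
  have hD0 : 0 ≤ D := abs_nonneg _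
  set c := L / (8 * R ^ 2) with hc
  have hc0 : 0 < c := by positivity
  have hlog16 : 0 < Real.log 16 := Real.log_pos (by norm_num)
  refine ⟨49 * R ^ 2 / 2 + L * D, 1 + 2 * (Real.log 16 + c), by positivity, by positivity, ?_⟩
  intro P P' _ _ hP hP' A hA B hB v hv hs k hk hkK
  have hk0 : (0 : ℝ) < k := by exact_mod_cast hk
  have hk1 : (1 : ℝ) ≤ k := by exact_mod_cast hk
  have hqA := hA.2 v
  have hqB := hB.2 v
  rw [hv] at hqA hqB
  simp only [one_pow, mul_one] at hqA hqB
  have hsk : 1 ≤ √(k : ℝ) := by rw [Real.one_le_sqrt]; exact hk1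
  have hcond : 2 ≤ 4 ^ k * (R * ((√(2 * π * (quadForm A v - quadForm B v)))⁻¹ *
      Real.exp (-(49 * R ^ 2 / (2 * (quadForm A v - quadForm B v)))))) := by
    set s := quadForm A v - quadForm B v with hsd
    have hsL : s ≤ L := by linarith
    have h4 : Real.exp (49 * R ^ 2 / (2 * s) + D) ≤ 4 ^ k := by
      calc Real.exp (49 * R ^ 2 / (2 * s) + D) ≤ Real.exp k := by
            apply Real.exp_le_exp.2
            have : (49 * R ^ 2 / 2 + L * D) / s ≤ k := by rwa [div_le_iff₀ hs]
            refine le_trans ?_ this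
            rw [le_div_iff₀ hs]
            have : (49 * R ^ 2 / (2 * s) + D) * s = 49 * R ^ 2 / 2 + s * D := by field_simp
            rw [this]
            gcongr
        _ = Real.exp 1 ^ k := by rw [← Real.exp_nat_mul, mul_one]
        _ ≤ 4 ^ k := by gcongr; linarith [Real.exp_one_lt_d9]
    have hDe : 2 * √(2 * π * s) / R ≤ Real.exp D := by
      calc 2 * √(2 * π * s) / R ≤ 2 * √(2 * π * L) / R := by gcongr
        _ = Real.exp (Real.log (2 * √(2 * π * L) / R)) := by rw [Real.exp_log (by positivity)]
        _ ≤ _ := Real.exp_le_exp.2 (le_abs_self _)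
    have hss : 0 < √(2 * π * s) := by positivity
    calc (2 : ℝ) = (Real.exp (49 * R ^ 2 / (2 * s)) * (2 * √(2 * π * s) / R)) * (R * ((√(2 * π * s))⁻¹ * Real.exp (-(49 * R ^ 2 / (2 * s))))) := by
          rw [Real.exp_neg]; field_simp
      _ ≤ (Real.exp (49 * R ^ 2 / (2 * s)) * Real.exp D) * (R * ((√(2 * π * s))⁻¹ * Real.exp (-(49 * R ^ 2 / (2 * s))))) := by gcongr
      _ ≤ _ := by rw [← Real.exp_add]; gcongr
  have hh : 0 < 1 / (2 * R * √(k:ℝ)) := by positivity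
  have hmain := caseB hR (matSet_posDef hl hA) (matSet_posDef hl hB) P P' hP hP' v hv hs hqB.2 hL.le
    (h := 1 / (2 * R * √(k:ℝ))) hh (by
      have : 6 * R * (1 / (2 * R * √(k:ℝ))) = 3 / √(k:ℝ) := by field_simp; norm_num
      rw [this, div_le_iff₀ (by positivity)]; linarith) k hcond
  set V := ∫ x, |gaussMix P A x - gaussMix P' B x|
  have hsq : √(k:ℝ) ^ 2 = k := Real.sq_sqrt hk0.le
  have e1 : (1 / (2 * R * √(k:ℝ))) ^ 2 * R ^ 2 = (4 * (k:ℝ))⁻¹ := by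
    rw [div_pow, mul_pow, hsq]; field_simp; norm_num
  have e2 : L * (1 / (2 * R * √(k:ℝ)) * k) ^ 2 / 2 = c * k := by
    rw [mul_pow, div_pow, mul_pow _ (√(k:ℝ)), hsq, hc]; field_simp; norm_num
  rw [e1, e2] at hmain
  have e3 : (4 * (k:ℝ))⁻¹ ^ k = Real.exp (-(k * Real.log (4 * k))) := by
    rw [← Real.log_pow, ← Real.log_inv, Real.exp_log (by positivity), inv_pow]
  have e4 : (4:ℝ) ^ k = Real.exp (k * Real.log 4) := by
    rw [← Real.log_pow, Real.exp_log (by positivity)]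
  rw [e3, e4, ← Real.exp_add] at hmain
  have h5 : Real.exp (-(k * Real.log (4 * k)) - (k * Real.log 4 + c * k)) ≤ V := by
    rw [Real.exp_sub, div_le_iff₀ (Real.exp_pos _)]; exact hmain
  refine le_trans (Real.exp_le_exp.2 ?_) h5
  have hlk : Real.log 2 ≤ Real.log (k + 1) := Real.log_le_log (by norm_num) (by linarith)
  have hl2 := Real.log_two_gt_d9
  have hlk2 : Real.log k ≤ Real.log (k+1) := Real.log_le_log hk0 (by linarith)
  have hl16 : Real.log 16 = 2 * Real.log 4 := by
    rw [show (16:ℝ) = 4 ^ 2 by norm_num, Real.log_pow]; norm_num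
  rw [Real.log_mul (by norm_num) hk0.ne']
  have h6 : 2 * Real.log 4 + Real.log k + c ≤ (1 + 2 * (Real.log 16 + c)) * Real.log (k + 1) := by
    rw [← hl16]; nlinarith
  nlinarith [mul_le_mul_of_nonneg_left h6 hk0.le]

lemma lemma1 {d : ℕ} {R l L : ℝ} (hR : 0 < R) (hl : 0 < l) (hlL : l < L) :
    ∃ K0 K1 : ℝ, 0 < K0 ∧ 0 < K1 ∧ ∀ (P P' : Measure (Euc d)), IsProbabilityMeasure P → IsProbabilityMeasure P' →
        P (closedBall 0 R)ᶜ = 0 → P' (closedBall 0 R)ᶜ = 0 →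
        ∀ A ∈ matSet d l L, ∀ B ∈ matSet d l L, ∀ v : Euc d, ‖v‖ = 1 → 
        ∀ k : ℕ, 1 ≤ k → K0 ≤ k * |quadForm A v - quadForm B v| →
        Real.exp (-(K1 * (k * Real.log (k + 1)))) ≤ ∫ x, |gaussMix P A x - gaussMix P' B x| := by
  obtain ⟨K0, K1, h0, h1, H⟩ := lemma1_pos (d := d) hR hl hlL
  refine ⟨K0, K1, h0, h1, ?_⟩
  intro P P' iP iP' hP hP' A hA B hB v hv k hk hkK
  rcases lt_trichotomy (quadForm A v - quadForm B v) 0 with hn | hz | hp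
  · have := H P' P iP' iP hP' hP B hB A hA v hv (by linarith) k hk (by rwa [abs_of_neg hn, neg_sub] at hkK)
    simp_rw [abs_sub_comm (gaussMix P A _)]
    exact this
  · rw [hz] at hkK; simp at hkK; linarith
  · exact H P P' iP iP' hP hP' A hA B hB v hv hp k hk (by rwa [abs_of_pos hp] at hkK)

lemma quadForm_sub' {d : ℕ} (A B : Matrix (Fin d) (Fin d) ℝ) (x : Euc d) :
    quadForm (A - B) x = quadForm A x - quadForm B x := by
  simp [quadForm, mul_sub, sub_mul, Finset.sum_sub_distrib]

lemma quadForm_inner {d : ℕ} (A : Matrix (Fin d) (Fin d) ℝ) (x : Euc d) :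
    quadForm A x = inner ℝ (Matrix.toEuclideanLin A x) x := by
  rw [quadForm_eq_dot]
  simp [EuclideanSpace.inner_eq_star_dotProduct, Matrix.toLpLin_apply]

lemma opNorm_le_of_quad {d : ℕ} {A : Matrix (Fin d) (Fin d) ℝ} (hA : A.IsSymm) {c : ℝ} (hc : 0 ≤ c)
    (h : ∀ x : Euc d, |quadForm A x| ≤ c * ‖x‖ ^ 2) : opNorm A ≤ c := by
  unfold opNorm
  refine ContinuousLinearMap.opNorm_le_bound _ hc fun x => ?_
  set T := Matrix.toEuclideanLin A with hT
  change ‖T x‖ ≤ c * ‖x‖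
  have hsym : ∀ x y : Euc d, inner ℝ (T x) y = inner ℝ (T y) x := by
    intro x y
    simp only [hT, EuclideanSpace.inner_eq_star_dotProduct, Matrix.toLpLin_apply, star_trivial]
    rw [Matrix.dotProduct_mulVec, ← Matrix.mulVec_transpose, hA.eq, dotProduct_comm]
  by_cases hx : T x = 0
  · rw [hx, norm_zero]; positivity
  have hTx : 0 < ‖T x‖ := norm_pos_iff.2 hx
  set y : Euc d := (‖x‖ / ‖T x‖) • T x with hy
  have hny : ‖y‖ = ‖x‖ := by
    rw [hy, norm_smul, Real.norm_of_nonneg (by positivity)]; field_simp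
  have h1 : inner ℝ (T x) y = ‖x‖ * ‖T x‖ := by
    rw [hy, inner_smul_right, real_inner_self_eq_norm_sq]; field_simp
  have h2 : 4 * inner ℝ (T x) y = quadForm A (x + y) - quadForm A (x - y) := by
    rw [quadForm_inner, quadForm_inner, ← hT, map_add, map_sub]
    simp only [inner_add_left, inner_add_right, inner_sub_left, inner_sub_right]
    rw [hsym y x]; ring
  have h3 := parallelogram_law_with_norm ℝ x y
  have h4 := abs_le.1 (h (x + y))
  have h5 := abs_le.1 (h (x - y))
  have h6 : ‖x‖ * ‖T x‖ ≤ c * ‖x‖ ^ 2 := by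
    rw [hny] at h3
    nlinarith
  have hx0 : 0 < ‖x‖ := by
    rw [norm_pos_iff]; rintro rfl; exact hx (map_zero _)
  nlinarith

lemma quad_of_unit {d : ℕ} {A : Matrix (Fin d) (Fin d) ℝ} {c : ℝ}
    (h : ∀ x : Euc d, ‖x‖ = 1 → |quadForm A x| ≤ c) (x : Euc d) : |quadForm A x| ≤ c * ‖x‖ ^ 2 := by
  by_cases hx : x = 0
  · subst hx; simp [quadForm]
  have hn : 0 < ‖x‖ := norm_pos_iff.2 hx
  have h1 := h (‖x‖⁻¹ • x) (by rw [norm_smul, norm_inv, norm_norm]; field_simp)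
  rw [quadForm_smul, abs_mul, abs_of_nonneg (by positivity)] at h1
  have : ‖x‖⁻¹ ^ 2 * |quadForm A x| * ‖x‖ ^ 2 ≤ c * ‖x‖ ^ 2 := by gcongr
  rwa [show ‖x‖⁻¹ ^ 2 * |quadForm A x| * ‖x‖ ^ 2 = |quadForm A x| by field_simp] at this

lemma opNorm_pos_of_ne {d : ℕ} {A B : Matrix (Fin d) (Fin d) ℝ} (h : A ≠ B) : 0 < opNorm (A - B) := by
  unfold opNorm
  rw [norm_pos_iff]
  intro h0
  apply h
  have h1 : Matrix.toEuclideanLin (A - B) = 0 := by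
    apply LinearMap.toContinuousLinearMap.injective
    rw [h0, map_zero]
  have : A - B = 0 := by
    apply Matrix.toEuclideanLin.injective
    rw [h1, map_zero]
  exact sub_eq_zero.1 this

lemma partSigma {d : ℕ} {R l L : ℝ} (hR : 0 < R) (hl : 0 < l) (hlL : l < L) :
    ∃ M c : ℝ, 0 < M ∧ 0 < c ∧ ∀ (P P' : Measure (Euc d)), IsProbabilityMeasure P → IsProbabilityMeasure P' →
        P (closedBall 0 R)ᶜ = 0 → P' (closedBall 0 R)ᶜ = 0 →
        ∀ A ∈ matSet d l L, ∀ B ∈ matSet d l L, A ≠ B → 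
        c * Real.exp (-(M * Real.log (1 / opNorm (A - B)) / opNorm (A - B))) ≤ ∫ x, |gaussMix P A x - gaussMix P' B x| := by
  obtain ⟨K0, K1, h0, h1, H⟩ := lemma1 (d := d) hR hl hlL
  have hL : 0 < L := hl.trans hlL
  set K2 := 2 * K0 + L with hK2
  have hK2p : 0 < K2 := by positivity
  set M := K1 * K2 * (2 * Real.log (K2 + 1) + 1) with hM
  have hlK : 0 < Real.log (K2 + 1) := Real.log_pos (by linarith)
  have hlK' : 0 < Real.log (2 * K2 + 1) := Real.log_pos (by linarith)
  have hMp : 0 < M := by positivity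
  refine ⟨M, Real.exp (-(K1 * (2 * K2 * Real.log (2 * K2 + 1))) - M), hMp, Real.exp_pos _, ?_⟩
  intro P P' iP iP' hP hP' A hA B hB hAB
  set δ := opNorm (A - B) with hδ
  have hδ0 : 0 < δ := opNorm_pos_of_ne hAB
  have hsymm : (A - B).IsSymm := hA.1.sub hB.1
  have hδL : δ ≤ L := by
    refine opNorm_le_of_quad hsymm hL.le (quad_of_unit fun x hx => ?_)
    have hqA := hA.2 x
    have hqB := hB.2 x
    rw [hx] at hqA hqB
    rw [quadForm_sub', abs_le]
    constructor <;> linarith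
  obtain ⟨v, hv, hvq⟩ : ∃ v : Euc d, ‖v‖ = 1 ∧ δ / 2 < |quadForm (A - B) v| := by
    by_contra! hcon
    have := opNorm_le_of_quad hsymm (by positivity) (quad_of_unit hcon)
    linarith
  rw [quadForm_sub'] at hvq
  set k := ⌈2 * K0 / δ⌉₊ with hk
  have hk1 : 1 ≤ k := Nat.one_le_iff_ne_zero.2 (by rw [hk]; exact (Nat.ceil_pos.2 (by positivity)).ne')
  have hkge : 2 * K0 / δ ≤ k := Nat.le_ceil _
  have hkle : (k : ℝ) ≤ K2 / δ := by
    have : (k : ℝ) < 2 * K0 / δ + 1 := Nat.ceil_lt_add_one (by positivity)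
    have h3 : 1 ≤ L / δ := by rw [le_div_iff₀ hδ0]; linarith
    rw [hK2, add_div]; linarith
  have hV := H P P' iP iP' hP hP' A hA B hB v hv k hk1 (by
    rw [div_le_iff₀ hδ0] at hkge
    have : (0:ℝ) ≤ k := by positivity
    nlinarith)
  refine le_trans ?_ hV
  rw [← Real.exp_add]
  apply Real.exp_le_exp.2
  have hklog : k * Real.log (k + 1) ≤ K2 / δ * Real.log (K2 / δ + 1) := by
    have : 0 ≤ Real.log ((k:ℝ) + 1) := Real.log_nonneg (by linarith [show (0:ℝ) ≤ k by positivity])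
    gcongr
  have hklog' := mul_le_mul_of_nonneg_left hklog h1.le
  rcases le_or_gt δ (1/2) with hd | hd
  · have hl2 : 1 / 2 ≤ Real.log (1 / δ) := by
      have : Real.log 2 ≤ Real.log (1 / δ) := Real.log_le_log (by norm_num) (by
        rw [le_div_iff₀ hδ0]; linarith)
      linarith [Real.log_two_gt_d9]
    have h6 : Real.log (K2 / δ + 1) ≤ (2 * Real.log (K2 + 1) + 1) * Real.log (1 / δ) := by
      have : Real.log (K2 / δ + 1) ≤ Real.log ((K2 + 1) * (1 / δ)) := by
        apply Real.log_le_log (by positivity)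
        have : 1 ≤ 1 / δ := by rw [le_div_iff₀ hδ0]; linarith
        rw [div_eq_mul_one_div]; linarith
      rw [Real.log_mul (by positivity) (by positivity)] at this
      nlinarith
    have h7 : K1 * (K2 / δ * Real.log (K2 / δ + 1)) ≤ M * Real.log (1 / δ) / δ := by
      calc _ ≤ K1 * (K2 / δ * ((2 * Real.log (K2 + 1) + 1) * Real.log (1 / δ))) := by gcongr
        _ = _ := by rw [hM]; ring
    have h8 : 0 ≤ K1 * (2 * K2 * Real.log (2 * K2 + 1)) := by positivity
    linarith
  · have h6 : K2 / δ ≤ 2 * K2 := by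
      rw [div_le_iff₀ hδ0]; nlinarith
    have h7 : K2 / δ * Real.log (K2 / δ + 1) ≤ 2 * K2 * Real.log (2 * K2 + 1) := by
      have : 0 ≤ Real.log (K2 / δ + 1) := Real.log_nonneg (by linarith [show 0 ≤ K2 / δ by positivity])
      gcongr
    have h8 : -(M * Real.log (1 / δ) / δ) ≤ M := by
      rw [one_div, Real.log_inv, mul_neg, neg_div, neg_neg, div_le_iff₀ hδ0]
      have := Real.log_le_self hδ0.le
      gcongr
    have h9 := mul_le_mul_of_nonneg_left h7 h1.le
    linarith

lemma integrable_rexp_sq {d : ℕ} {b : ℝ} (hb : 0 < b) :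
    Integrable (fun t : Euc d => Real.exp (-b * ‖t‖ ^ 2)) := by
  have := (GaussianFourier.integrable_cexp_neg_mul_sq_norm_add (V := Euc d) (b := (b : ℂ)) (by simpa using hb) 0 0).norm
  refine this.congr (Filter.Eventually.of_forall fun t => ?_)
  simp only [Complex.norm_exp]
  congr 1
  simp [← Complex.ofReal_pow]

lemma integral_rexp_sq {d : ℕ} {b : ℝ} (hb : 0 < b) :
    ∫ t : Euc d, Real.exp (-b * ‖t‖ ^ 2) = (π / b) ^ ((d : ℝ) / 2) := by
  rw [GaussianFourier.integral_rexp_neg_mul_sq_norm hb]; simp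

lemma gauss_inv {d : ℕ} {σ : ℝ} (hσ : 0 < σ) (z : Euc d) :
    ∫ t : Euc d, Complex.exp (-((σ ^ 2 / 2 : ℝ) : ℂ) * ‖t‖ ^ 2 + Complex.I * inner ℝ z t) =
      (((2 * π / σ ^ 2) ^ ((d : ℝ) / 2) * Real.exp (-(‖z‖ ^ 2 / (2 * σ ^ 2))) : ℝ) : ℂ) := by
  have hre : 0 < ((σ ^ 2 / 2 : ℝ) : ℂ).re := by rw [Complex.ofReal_re]; positivity
  rw [GaussianFourier.integral_cexp_neg_mul_sq_norm_add hre]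
  rw [Complex.ofReal_mul]
  congr 1
  · rw [Complex.ofReal_cpow (by positivity)]
    congr 1
    · push_cast; field_simp
    · simp
  · rw [Complex.ofReal_exp]
    congr 1
    rw [Complex.I_sq]; push_cast; field_simp; norm_num

lemma gauss_inv_mix {d : ℕ} {σ : ℝ} (hσ : 0 < σ) (P : Measure (Euc d)) [IsProbabilityMeasure P] (x : Euc d) :
    (((2 * π / σ ^ 2) ^ ((d : ℝ) / 2) * ∫ θ, Real.exp (-(‖θ - x‖ ^ 2 / (2 * σ ^ 2))) ∂P : ℝ) : ℂ) =
    ∫ t : Euc d, (Real.exp (-(σ ^ 2 / 2) * ‖t‖ ^ 2) : ℂ) * Complex.exp (-(inner ℝ x t * Complex.I)) * charFun P t := by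
  rw [← integral_const_mul, ← integral_complex_ofReal]
  simp_rw [← gauss_inv hσ]
  rw [integral_integral_swap]
  · congr 1
    funext t
    rw [charFun_apply, ← integral_const_mul]
    congr 1
    funext θ
    rw [Complex.ofReal_exp, ← Complex.exp_add, ← Complex.exp_add]
    congr 1
    rw [inner_sub_left]; push_cast; ring
  · have h1 : Integrable (fun p : Euc d × Euc d => Real.exp (-(σ ^ 2 / 2) * ‖p.2‖ ^ 2)) (P.prod volume) :=
      (integrable_rexp_sq (d := d) (b := σ ^ 2 / 2) (by positivity)).comp_snd P
    refine h1.mono' (Continuous.aestronglyMeasurable (by unfold Function.uncurry; fun_prop)) (Filter.Eventually.of_forall fun p => ?_)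
    simp only [Function.uncurry, Complex.norm_exp]
    apply le_of_eq
    congr 1
    simp [← Complex.ofReal_pow]

lemma smooth_pt {d : ℕ} {σ F E : ℝ} (hσ : 0 < σ) (P P' : Measure (Euc d))
    [IsProbabilityMeasure P] [IsProbabilityMeasure P']
    (h : ∀ t : Euc d, ‖charFun P t - charFun P' t‖ ≤ F + E * Real.exp (σ ^ 2 / 4 * ‖t‖ ^ 2)) (x : Euc d) :
    |(∫ θ, Real.exp (-(‖θ - x‖ ^ 2 / (2 * σ ^ 2))) ∂P) - ∫ θ, Real.exp (-(‖θ - x‖ ^ 2 / (2 * σ ^ 2))) ∂P'|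
      ≤ F + 2 ^ ((d : ℝ) / 2) * E := by
  set c := (2 * π / σ ^ 2) ^ ((d : ℝ) / 2) with hc
  have hc0 : 0 < c := by positivity
  have hInteg : ∀ (P : Measure (Euc d)) [IsProbabilityMeasure P], Integrable (fun t : Euc d =>
      (Real.exp (-(σ ^ 2 / 2) * ‖t‖ ^ 2) : ℂ) * Complex.exp (-(inner ℝ x t * Complex.I)) * charFun P t) := by
    intro P _
    refine (integrable_rexp_sq (d := d) (b := σ ^ 2 / 2) (by positivity)).mono' ?_ (Filter.Eventually.of_forall fun t => ?_)
    · have h1 : AEStronglyMeasurable (charFun P) (volume : Measure (Euc d)) := (stronglyMeasurable_charFun).aestronglyMeasurable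
      refine AEStronglyMeasurable.mul (Continuous.aestronglyMeasurable (by fun_prop)) h1
    · rw [norm_mul, norm_mul, Complex.norm_real, Real.norm_of_nonneg (Real.exp_pos _).le, ← neg_mul, ← Complex.ofReal_neg,
        Complex.norm_exp_ofReal_mul_I, mul_one]
      exact mul_le_of_le_one_right (Real.exp_pos _).le (norm_charFun_le_one t)
  have h1 := gauss_inv_mix hσ P x
  have h2 := gauss_inv_mix hσ P' x
  rw [← hc] at h1 h2
  set a := ∫ θ, Real.exp (-(‖θ - x‖ ^ 2 / (2 * σ ^ 2))) ∂P
  set a' := ∫ θ, Real.exp (-(‖θ - x‖ ^ 2 / (2 * σ ^ 2))) ∂P'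
  have i1 := (integrable_rexp_sq (d := d) (b := σ ^ 2 / 2) (by positivity)).const_mul F
  have i2 := (integrable_rexp_sq (d := d) (b := σ ^ 2 / 4) (by positivity)).const_mul E
  have h3 : c * |a - a'| ≤ ∫ t : Euc d, (F * Real.exp (-(σ ^ 2 / 2) * ‖t‖ ^ 2) + E * Real.exp (-(σ ^ 2 / 4) * ‖t‖ ^ 2)) := by
    have e : c * |a - a'| = ‖((c * a : ℝ) : ℂ) - ((c * a' : ℝ) : ℂ)‖ := by
      rw [← Complex.ofReal_sub, Complex.norm_real, ← mul_sub, norm_mul, Real.norm_of_nonneg hc0.le, Real.norm_eq_abs]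
    rw [e, h1, h2, ← integral_sub (hInteg P) (hInteg P')]
    refine norm_integral_le_of_norm_le (i1.add i2) (Filter.Eventually.of_forall fun t => ?_)
    rw [← mul_sub, norm_mul, norm_mul, Complex.norm_real, Real.norm_of_nonneg (Real.exp_pos _).le, ← neg_mul, ← Complex.ofReal_neg,
        Complex.norm_exp_ofReal_mul_I, mul_one]
    calc _ ≤ Real.exp (-(σ ^ 2 / 2) * ‖t‖ ^ 2) * (F + E * Real.exp (σ ^ 2 / 4 * ‖t‖ ^ 2)) := by gcongr; exact h t
      _ = F * Real.exp (-(σ ^ 2 / 2) * ‖t‖ ^ 2) + E * (Real.exp (-(σ ^ 2 / 2) * ‖t‖ ^ 2) * Real.exp (σ ^ 2 / 4 * ‖t‖ ^ 2)) := by ring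
      _ = _ := by rw [← Real.exp_add]; congr 3; ring
  rw [integral_add i1 i2, integral_const_mul, integral_const_mul, integral_rexp_sq (by positivity), integral_rexp_sq (by positivity)] at h3
  have e1 : (π / (σ ^ 2 / 2)) ^ ((d : ℝ) / 2) = c := by rw [hc]; congr 1; field_simp
  have e2 : (π / (σ ^ 2 / 4)) ^ ((d : ℝ) / 2) = 2 ^ ((d : ℝ) / 2) * c := by
    rw [hc, ← Real.mul_rpow (by positivity) (by positivity)]; congr 1; field_simp; norm_num
  rw [e1, e2] at h3
  have : c * |a - a'| ≤ c * (F + 2 ^ ((d : ℝ) / 2) * E) := by linarith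
  exact le_of_mul_le_mul_left this hc0

/-- truncated Lipschitz function -/
lemma exists_trunc {d : ℕ} {R : ℝ} (hR : 0 < R) (h : Euc d → ℝ) (hh : LipschitzWith 1 h) :
    ∃ g : Euc d → ℝ, LipschitzWith 1 g ∧ (∀ x, ‖x‖ ≤ R → g x = h x - h 0) ∧ (∀ x, |g x| ≤ 2 * R) ∧
      (∀ x, x ∉ closedBall (0 : Euc d) (2 * R) → g x = 0) := by
  have hu : LipschitzWith 1 (fun x : Euc d => max (2 * R - ‖x‖) 0) := by
    have : LipschitzWith 1 (fun x : Euc d => 2 * R - ‖x‖) := by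
      refine LipschitzWith.of_dist_le_mul fun x y => ?_
      rw [Real.dist_eq, dist_eq_norm]
      have := abs_norm_sub_norm_le y x
      rw [norm_sub_rev y x] at this
      simpa using this
    simpa using this.max (LipschitzWith.const (0:ℝ) |>.weaken zero_le_one)
  have hh0 : LipschitzWith 1 (fun x : Euc d => h x - h 0) := by
    refine LipschitzWith.of_dist_le_mul fun x y => ?_
    have := hh.dist_le_mul x y
    simpa [Real.dist_eq] using this
  have hun : LipschitzWith 1 (fun x : Euc d => -max (2 * R - ‖x‖) 0) := by
    refine LipschitzWith.of_dist_le_mul fun x y => ?_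
    have := hu.dist_le_mul x y
    rwa [dist_neg_neg]
  have hb : ∀ x, |h x - h 0| ≤ ‖x‖ := fun x => by
    have := hh.dist_le_mul x 0
    simpa [Real.dist_eq] using this
  refine ⟨fun x => max (-max (2 * R - ‖x‖) 0) (min (h x - h 0) (max (2 * R - ‖x‖) 0)), ?_, ?_, ?_, ?_⟩
  · have h1 := hh0.min hu
    rw [max_self] at h1
    have h2 := hun.max h1
    rwa [max_self] at h2
  · intro x hx
    have h1 := abs_le.1 (hb x)
    have h2 : 2 * R - ‖x‖ ≤ max (2 * R - ‖x‖) 0 := le_max_left _ _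
    beta_reduce
    rw [min_eq_left (by linarith), max_eq_right (by linarith)]
  · intro x
    have h0 : 0 ≤ max (2 * R - ‖x‖) 0 := le_max_right _ _
    have h1 : max (2 * R - ‖x‖) 0 ≤ 2 * R := max_le (by linarith [norm_nonneg x]) (by linarith)
    beta_reduce
    rw [abs_le]
    constructor
    · exact le_trans (by linarith) (le_max_left _ _)
    · exact max_le (by linarith) ((min_le_right _ _).trans h1)
  · intro x hx
    have : 2 * R < ‖x‖ := by simpa using hx
    beta_reduce
    rw [max_eq_right (a := 2 * R - ‖x‖) (by linarith)]
    rw [neg_zero]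
    exact max_eq_left (min_le_right _ _)

lemma smooth_moment {d : ℕ} {σ : ℝ} (hσ : 0 < σ) (g : Euc d → ℝ) (hg : LipschitzWith 1 g)
    {S : ℝ} (hgb : ∀ x, |g x| ≤ S) (θ : Euc d) :
    |(2 * π * σ ^ 2) ^ ((d : ℝ) / 2) * g θ - ∫ x, g x * Real.exp (-(‖θ - x‖ ^ 2 / (2 * σ ^ 2)))|
      ≤ σ * (2 ^ ((d : ℝ) / 2) * (2 * π * σ ^ 2) ^ ((d : ℝ) / 2)) := by
  have hZ : ∀ b : ℝ, 0 < b → Integrable (fun x : Euc d => Real.exp (-b * ‖θ - x‖ ^ 2)) := fun b hb =>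
    (integrable_rexp_sq (d := d) hb).comp_sub_left θ
  have hZi : ∀ b : ℝ, 0 < b → ∫ x : Euc d, Real.exp (-b * ‖θ - x‖ ^ 2) = (π / b) ^ ((d : ℝ) / 2) := fun b hb => by
    rw [← integral_rexp_sq hb]
    exact integral_sub_left_eq_self (fun x : Euc d => Real.exp (-b * ‖x‖ ^ 2)) volume θ
  have hex : ∀ x : Euc d, Real.exp (-(‖θ - x‖ ^ 2 / (2 * σ ^ 2))) = Real.exp (-(1 / (2 * σ ^ 2)) * ‖θ - x‖ ^ 2) := fun x => by
    congr 1; ring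
  simp_rw [hex]
  have h1 : 0 < 1 / (2 * σ ^ 2) := by positivity
  have h2 : 0 < 1 / (4 * σ ^ 2) := by positivity
  have e1 : (π / (1 / (2 * σ ^ 2))) ^ ((d : ℝ) / 2) = (2 * π * σ ^ 2) ^ ((d : ℝ) / 2) := by
    congr 1; field_simp
  have e2 : (π / (1 / (4 * σ ^ 2))) ^ ((d : ℝ) / 2) = 2 ^ ((d : ℝ) / 2) * (2 * π * σ ^ 2) ^ ((d : ℝ) / 2) := by
    rw [← Real.mul_rpow (by positivity) (by positivity)]; congr 1; field_simp; norm_num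
  rw [← e2, ← e1, ← hZi _ h1, ← hZi _ h2, ← integral_mul_const, ← integral_sub, ← integral_const_mul, ← Real.norm_eq_abs]
  · refine norm_integral_le_of_norm_le ((hZ _ h2).const_mul σ) (Filter.Eventually.of_forall fun x => ?_)
    have hl : |g θ - g x| ≤ ‖θ - x‖ := by
      have := hg.dist_le_mul θ x
      simpa [Real.dist_eq, dist_eq_norm] using this
    have hu : ‖θ - x‖ ≤ σ * Real.exp (1 / (4 * σ ^ 2) * ‖θ - x‖ ^ 2) := by
      have ha := Real.add_one_le_exp (1 / (4 * σ ^ 2) * ‖θ - x‖ ^ 2)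
      have hb : ‖θ - x‖ ≤ σ * (1 / (4 * σ ^ 2) * ‖θ - x‖ ^ 2 + 1) := by
        have : σ * (1 / (4 * σ ^ 2) * ‖θ - x‖ ^ 2 + 1) - ‖θ - x‖ = σ * (‖θ - x‖ / (2 * σ) - 1) ^ 2 := by
          field_simp; ring
        have : 0 ≤ σ * (‖θ - x‖ / (2 * σ) - 1) ^ 2 := by positivity
        linarith
      exact hb.trans (by gcongr)
    rw [show Real.exp (-(1 / (2 * σ ^ 2)) * ‖θ - x‖ ^ 2) * g θ - g x * Real.exp (-(1 / (2 * σ ^ 2)) * ‖θ - x‖ ^ 2)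
      = (g θ - g x) * Real.exp (-(1 / (2 * σ ^ 2)) * ‖θ - x‖ ^ 2) by ring, Real.norm_eq_abs, abs_mul, abs_of_pos (Real.exp_pos _)]
    calc _ ≤ (σ * Real.exp (1 / (4 * σ ^ 2) * ‖θ - x‖ ^ 2)) * Real.exp (-(1 / (2 * σ ^ 2)) * ‖θ - x‖ ^ 2) := by
            gcongr; exact hl.trans hu
      _ = σ * Real.exp (-(1 / (4 * σ ^ 2)) * ‖θ - x‖ ^ 2) := by
            rw [mul_assoc, ← Real.exp_add]; congr 2; field_simp; ring
  · exact (hZ _ h1).mul_const _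
  · exact (hZ _ h1).bdd_mul (c := S) hg.continuous.aestronglyMeasurable (Filter.Eventually.of_forall fun x => by
      simpa using hgb x)

lemma smooth_W {d : ℕ} {R σ F E : ℝ} (hR : 0 < R) (hσ : 0 < σ) (P P' : Measure (Euc d))
    [IsProbabilityMeasure P] [IsProbabilityMeasure P']
    (hP : P (closedBall 0 R)ᶜ = 0) (hP' : P' (closedBall 0 R)ᶜ = 0)
    (hc : ∀ t : Euc d, ‖charFun P t - charFun P' t‖ ≤ F + E * Real.exp (σ ^ 2 / 4 * ‖t‖ ^ 2))
    (h : Euc d → ℝ) (hh : LipschitzWith 1 h) :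
    (∫ x, h x ∂P) - ∫ x, h x ∂P' ≤ 2 * 2 ^ ((d : ℝ) / 2) * σ +
      (2 * R * (volume (closedBall (0 : Euc d) (2 * R))).toReal) * ((2 * π * σ ^ 2) ^ ((d : ℝ) / 2))⁻¹ *
        (F + 2 ^ ((d : ℝ) / 2) * E) := by
  obtain ⟨g, hg, hgh, hgb, hgs⟩ := exists_trunc hR h hh
  have hgc := hg.continuous
  set Z := (2 * π * σ ^ 2) ^ ((d : ℝ) / 2) with hZ
  have hZ0 : 0 < Z := by positivity
  set Q := (2 : ℝ) ^ ((d : ℝ) / 2) with hQ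
  set ε := F + Q * E with hε
  have gi : ∀ (P : Measure (Euc d)) [IsProbabilityMeasure P], Integrable g P := fun P _ =>
    (integrable_const (2 * R)).mono' hgc.aestronglyMeasurable (Filter.Eventually.of_forall fun x => by simpa using hgb x)
  have hi : ∀ (P : Measure (Euc d)) [IsProbabilityMeasure P], P (closedBall 0 R)ᶜ = 0 →
      ∫ x, h x ∂P = (∫ x, g x ∂P) + h 0 := by
    intro P _ hP
    have : ∫ x, h x ∂P = ∫ x, (g x + h 0) ∂P := integral_congr_ae (by
      filter_upwards [ae_ball hP] with x hx
      rw [hgh x hx]; ring)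
    rw [this, integral_add (gi P) (integrable_const _)]; simp
  have hfin : volume (closedBall (0 : Euc d) (2 * R)) < ⊤ := measure_closedBall_lt_top
  have hind : ∀ x, ‖g x‖ ≤ (closedBall (0 : Euc d) (2 * R)).indicator (fun _ => 2 * R) x := by
    intro x
    by_cases hx : x ∈ closedBall (0 : Euc d) (2 * R)
    · rw [Set.indicator_of_mem hx]; exact hgb x
    · rw [Set.indicator_of_notMem hx, hgs x hx]; simp
  have hindI : Integrable ((closedBall (0 : Euc d) (2 * R)).indicator (fun _ => 2 * R)) :=
    (integrable_indicator_iff measurableSet_closedBall).2 (integrableOn_const (C := 2 * R) hfin.ne)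
  have gv : Integrable g := by
    exact hindI.mono' hgc.aestronglyMeasurable (Filter.Eventually.of_forall hind)
  have gvi : ∫ x, |g x| ≤ 2 * R * (volume (closedBall (0 : Euc d) (2 * R))).toReal := by
    have h1 : ∫ x, |g x| ≤ ∫ x, (closedBall (0 : Euc d) (2 * R)).indicator (fun _ => 2 * R) x :=
      integral_mono gv.abs hindI hind
    rw [integral_indicator measurableSet_closedBall] at h1
    simp only [integral_const, smul_eq_mul, measureReal_def, Measure.restrict_apply_univ] at h1
    linarith
  -- convolution functional
  let G : Euc d → ℝ := fun θ => ∫ x, g x * Real.exp (-(‖θ - x‖ ^ 2 / (2 * σ ^ 2)))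
  have hprod : ∀ (P : Measure (Euc d)) [IsProbabilityMeasure P],
      Integrable (Function.uncurry fun θ x => g x * Real.exp (-(‖θ - x‖ ^ 2 / (2 * σ ^ 2)))) (P.prod volume) := by
    intro P _
    refine (gv.norm.comp_snd P).mono' (Continuous.aestronglyMeasurable (by unfold Function.uncurry; fun_prop)) (Filter.Eventually.of_forall fun p => ?_)
    simp only [Function.uncurry, norm_mul, Real.norm_eq_abs, Real.abs_exp]
    refine mul_le_of_le_one_right (abs_nonneg _) (Real.exp_le_one_iff.2 ?_)
    have : 0 ≤ ‖p.1 - p.2‖ ^ 2 / (2 * σ ^ 2) := by positivity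
    linarith
  have hGi : ∀ (P : Measure (Euc d)) [IsProbabilityMeasure P], Integrable G P := fun P _ =>
    (hprod P).integral_prod_left
  have hGd : ∀ (P : Measure (Euc d)) [IsProbabilityMeasure P], |Z * (∫ x, g x ∂P) - ∫ θ, G θ ∂P| ≤ σ * (Q * Z) := by
    intro P _
    rw [← integral_const_mul, ← integral_sub ((gi P).const_mul Z) (hGi P), ← Real.norm_eq_abs]
    have := norm_integral_le_of_norm_le (μ := P) (f := fun θ => Z * g θ - G θ) (integrable_const (σ * (Q * Z)))
      (Filter.Eventually.of_forall fun θ => smooth_moment hσ g hg hgb θ)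
    simpa using this
  have hsw : ∀ (P : Measure (Euc d)) [IsProbabilityMeasure P],
      ∫ θ, G θ ∂P = ∫ x, g x * ∫ θ, Real.exp (-(‖θ - x‖ ^ 2 / (2 * σ ^ 2))) ∂P := by
    intro P _
    simp only [G]
    rw [integral_integral_swap (hprod P)]
    simp_rw [integral_const_mul]
  have hsi : ∀ (P : Measure (Euc d)) [IsProbabilityMeasure P],
      Integrable (fun x => g x * ∫ θ, Real.exp (-(‖θ - x‖ ^ 2 / (2 * σ ^ 2))) ∂P) := by
    intro P _
    have := (hprod P).integral_prod_right
    simpa [Function.uncurry, integral_const_mul] using this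
  have hdiff : (∫ θ, G θ ∂P) - ∫ θ, G θ ∂P' ≤ (2 * R * (volume (closedBall (0 : Euc d) (2 * R))).toReal) * ε := by
    have hε0 : 0 ≤ ε := (abs_nonneg _).trans (smooth_pt hσ P P' hc 0)
    rw [hsw P, hsw P', ← integral_sub (hsi P) (hsi P')]
    calc _ ≤ ∫ x, |g x| * ε := by
          refine integral_mono ((hsi P).sub (hsi P')) (gv.abs.mul_const ε) fun x => ?_
          simp only [← mul_sub]
          refine (le_abs_self _).trans ?_
          rw [abs_mul]
          gcongr
          exact smooth_pt hσ P P' hc x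
      _ = (∫ x, |g x|) * ε := integral_mul_const _ _
      _ ≤ _ := by gcongr
  have a1 := abs_le.1 (hGd P)
  have a2 := abs_le.1 (hGd P')
  rw [hi P hP, hi P' hP']
  set H := 2 * R * (volume (closedBall (0 : Euc d) (2 * R))).toReal
  have key : Z * ((∫ x, g x ∂P) - ∫ x, g x ∂P') ≤ Z * (2 * Q * σ + H * Z⁻¹ * ε) := by
    have : Z * (2 * Q * σ + H * Z⁻¹ * ε) = 2 * Q * σ * Z + H * ε := by field_simp
    rw [this]; nlinarith [a1.1, a1.2, a2.1, a2.2]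
  have := le_of_mul_le_mul_left key hZ0
  linarith

lemma const_le_exp {c x0 x : ℝ} (hc : 0 ≤ c) (h0 : 0 < x0) (hx : x0 ≤ x) : c ≤ Real.exp (c / x0 * x) := by
  have h1 : c ≤ c / x0 * x := by
    rw [div_mul_eq_mul_div, le_div_iff₀ h0]; gcongr
  linarith [Real.add_one_le_exp (c / x0 * x)]

set_option maxHeartbeats 1000000 in
lemma num_bound {K0 K1 L Q x0 p : ℝ} (hK0 : 0 < K0) (hK1 : 0 < K1) (hL : 0 < L) (hQ : 0 < Q) (h0 : 0 < x0) (hp : 0 < p) :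
    ∃ a τ : ℝ, 0 < a ∧ 0 < τ ∧ ∀ x, x0 ≤ x → ∀ k : ℕ, Real.exp (a * x) ≤ k → ∀ V : ℝ,
      V ≤ Real.exp (-(K1 * (k * Real.log (k + 1)))) →
      V * Real.exp (L * (τ * x ^ 2) / 2) + (K0 / k * (τ * x ^ 2)) * Real.exp (K0 / k * (τ * x ^ 2))
        + Q * (2 * Real.exp (-(τ * x / (1024 * Q ^ 2)))) ≤ Real.exp (-(p * x)) / 4 := by
  set q := p + 12 / x0 with hq
  have hq0 : 0 < q := by positivity
  set τ := 1024 * Q ^ 2 * (q + 2 * Q / x0) with hτ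
  have hτ0 : 0 < τ := by positivity
  set b := 2 * K0 * τ / x0 with hb
  have hb0 : 0 < b := by positivity
  set e := 4 / K1 * (L * τ / 2 + q / x0) with he
  have he0 : 0 < e := by positivity
  set a := 1 + b + 1 / x0 + q + e with ha
  have hi0 : 0 < 1 / x0 := by positivity
  have ha0 : 0 < a := by positivity
  clear_value a e b τ q
  refine ⟨a, τ, ha0, hτ0, ?_⟩
  intro x hx k hk V hV
  have hx0 : 0 < x := h0.trans_le hx
  have hkp : (0 : ℝ) < k := (Real.exp_pos _).trans_le hk
  have hq12 : 12 * Real.exp (-(q * x)) ≤ Real.exp (-(p * x)) := by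
    have := const_le_exp (c := 12) (by norm_num) h0 hx
    calc 12 * Real.exp (-(q * x)) ≤ Real.exp (12 / x0 * x) * Real.exp (-(q * x)) := by gcongr
      _ = _ := by rw [← Real.exp_add]; congr 1; rw [hq]; ring
  have t1 : V * Real.exp (L * (τ * x ^ 2) / 2) ≤ Real.exp (-(q * x)) := by
    have hk1 : (1 : ℝ) ≤ k := by
      have : 0 < k := by exact_mod_cast hkp
      exact_mod_cast this
    have hlog : 1 / 2 ≤ Real.log (k + 1) := by
      have : Real.log 2 ≤ Real.log (k + 1) := Real.log_le_log (by norm_num) (by linarith)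
      linarith [Real.log_two_gt_d9]
    have hex : a * x ^ 2 / 2 ≤ Real.exp (a * x) := by
      have h1 := Real.quadratic_le_exp_of_nonneg (x := a * x) (by positivity)
      have h2 : 1 ≤ a := by rw [ha]; linarith
      have h3 : a * x ^ 2 ≤ (a * x) ^ 2 := by
        rw [mul_pow]; gcongr; nlinarith
      have : 0 < a * x := by positivity
      linarith
    have hkl : e * x ^ 2 / 4 ≤ k * Real.log (k + 1) := by
      have : e * x ^ 2 ≤ a * x ^ 2 := by gcongr; rw [ha]; linarith
      nlinarith
    have hke : K1 * (e * x ^ 2 / 4) = L * (τ * x ^ 2) / 2 + q / x0 * x ^ 2 := by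
      rw [he]; field_simp
    have hqx : q * x ≤ q / x0 * x ^ 2 := by
      rw [div_mul_eq_mul_div, le_div_iff₀ h0]
      nlinarith [mul_pos hq0 hx0]
    have := mul_le_mul_of_nonneg_left hkl hK1.le
    calc _ ≤ Real.exp (-(K1 * (k * Real.log (k + 1)))) * Real.exp (L * (τ * x ^ 2) / 2) := by gcongr
      _ = Real.exp (-(K1 * (k * Real.log (k + 1))) + L * (τ * x ^ 2) / 2) := by rw [Real.exp_add]
      _ ≤ _ := Real.exp_le_exp.2 (by linarith)
  have t2 : (K0 / k * (τ * x ^ 2)) * Real.exp (K0 / k * (τ * x ^ 2)) ≤ Real.exp (-(q * x)) := by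
    have hk' : K0 / k ≤ K0 * Real.exp (-(a * x)) := by
      rw [Real.exp_neg, ← div_eq_mul_inv]; gcongr
    have hx2 : x ^ 2 ≤ 2 * Real.exp x := by
      have h1 := Real.quadratic_le_exp_of_nonneg (x := x) hx0.le
      linarith
    have hbx := const_le_exp (c := 2 * K0 * τ) (by positivity) h0 hx
    rw [← hb] at hbx
    have hu : K0 / k * (τ * x ^ 2) ≤ Real.exp (-((1 / x0 + q) * x)) := by
      calc _ ≤ K0 * Real.exp (-(a * x)) * (τ * (2 * Real.exp x)) := by gcongr
        _ = (2 * K0 * τ) * (Real.exp (-(a * x)) * Real.exp x) := by ring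
        _ ≤ Real.exp (b * x) * (Real.exp (-(a * x)) * Real.exp x) := by gcongr
        _ = Real.exp (b * x + (-(a * x) + x)) := by rw [Real.exp_add, Real.exp_add]
        _ ≤ _ := Real.exp_le_exp.2 (by rw [ha]; nlinarith)
    have hu1 : K0 / k * (τ * x ^ 2) ≤ 1 / x0 * x := by
      have h1 : Real.exp (-((1 / x0 + q) * x)) ≤ 1 := Real.exp_le_one_iff.2 (by
        have : 0 < (1 / x0 + q) * x := by positivity
        linarith)
      have h2 : 1 ≤ 1 / x0 * x := by rw [div_mul_eq_mul_div, le_div_iff₀ h0]; linarith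
      linarith
    calc _ ≤ Real.exp (-((1 / x0 + q) * x)) * Real.exp (1 / x0 * x) := by gcongr
      _ = _ := by rw [← Real.exp_add]; congr 1; ring
  have t3 : Q * (2 * Real.exp (-(τ * x / (1024 * Q ^ 2)))) ≤ Real.exp (-(q * x)) := by
    have h1 := const_le_exp (c := 2 * Q) (by positivity) h0 hx
    have h2 : τ * x / (1024 * Q ^ 2) = (q + 2 * Q / x0) * x := by rw [hτ]; field_simp
    rw [h2]
    calc _ = 2 * Q * Real.exp (-((q + 2 * Q / x0) * x)) := by ring
      _ ≤ Real.exp (2 * Q / x0 * x) * Real.exp (-((q + 2 * Q / x0) * x)) := by gcongr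
      _ = _ := by rw [← Real.exp_add]; congr 1; ring
  linarith

lemma char_diff {d : ℕ} {l L V η : ℝ} (hl : 0 < l) (P P' : Measure (Euc d))
    [IsProbabilityMeasure P] [IsProbabilityMeasure P'] {A B : Matrix (Fin d) (Fin d) ℝ}
    (hA : A ∈ matSet d l L) (hB : B ∈ matSet d l L)
    (hV : ∫ x, |gaussMix P A x - gaussMix P' B x| ≤ V)
    (hη : ∀ t : Euc d, |quadForm A t - quadForm B t| ≤ η * ‖t‖ ^ 2) (t : Euc d) :
    ‖charFun P t - charFun P' t‖ ≤ V * Real.exp (L * ‖t‖ ^ 2 / 2) + η * ‖t‖ ^ 2 * Real.exp (η * ‖t‖ ^ 2) := by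
  have h1 := (char_le_V (matSet_posDef hl hA) (matSet_posDef hl hB) P P' t).trans hV
  set a := quadForm A t
  set b := quadForm B t
  have hab := hη t
  have e : charFun P t - charFun P' t = Complex.exp ((a : ℂ) / 2) * (charFun P t * Complex.exp (-(a : ℂ) / 2) - charFun P' t * Complex.exp (-(b : ℂ) / 2))
      + charFun P' t * (Complex.exp (((a - b) / 2 : ℝ) : ℂ) - 1) := by
    have e1 : Complex.exp ((a : ℂ) / 2) * Complex.exp (-(a : ℂ) / 2) = 1 := by
      rw [← Complex.exp_add]; ring_nf; simp
    have e2 : Complex.exp ((a : ℂ) / 2) * Complex.exp (-(b : ℂ) / 2) = Complex.exp (((a - b) / 2 : ℝ) : ℂ) := by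
      rw [← Complex.exp_add]; push_cast; ring_nf
    linear_combination (-charFun P t) * e1 + charFun P' t * e2
  rw [e]
  refine (norm_add_le _ _).trans (add_le_add ?_ ?_)
  · rw [norm_mul, mul_comm]
    have hn : ‖Complex.exp ((a : ℂ) / 2)‖ ≤ Real.exp (L * ‖t‖ ^ 2 / 2) := by
      rw [Complex.norm_exp]
      apply Real.exp_le_exp.2
      have := (hA.2 t).2
      have e3 : ((a : ℂ) / 2).re = a / 2 := by simp
      rw [e3]; linarith
    exact mul_le_mul h1 hn (norm_nonneg _) ((norm_nonneg _).trans h1)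
  · rw [norm_mul]
    have h2 : ‖charFun P' t‖ ≤ 1 := norm_charFun_le_one t
    have h3 : ‖Complex.exp (((a - b) / 2 : ℝ) : ℂ) - 1‖ ≤ η * ‖t‖ ^ 2 * Real.exp (η * ‖t‖ ^ 2) := by
      rw [← Complex.ofReal_exp, ← Complex.ofReal_one, ← Complex.ofReal_sub, Complex.norm_real, Real.norm_eq_abs]
      set u := (a - b) / 2
      set w := η * ‖t‖ ^ 2
      have hu : |u| ≤ w := by
        have : |u| = |a - b| / 2 := by simp [u, abs_div]
        linarith [abs_nonneg (a - b)]
      have hu' := abs_le.1 hu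
      have hw : 0 ≤ w := (abs_nonneg _).trans hu
      have f1 := Real.add_one_le_exp u
      have f2 := Real.add_one_le_exp (-w)
      have f3 : Real.exp u ≤ Real.exp w := Real.exp_le_exp.2 hu'.2
      have f4 : Real.exp w * Real.exp (-w) = 1 := by rw [← Real.exp_add]; simp
      have f5 : 1 ≤ Real.exp w := Real.one_le_exp hw
      rw [abs_le]; constructor <;> nlinarith [Real.exp_pos w]
    calc _ ≤ 1 * _ := mul_le_mul h2 h3 (norm_nonneg _) zero_le_one
      _ = _ := one_mul _

lemma lip_diff_le {d : ℕ} {R : ℝ} (P P' : Measure (Euc d))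
    [IsProbabilityMeasure P] [IsProbabilityMeasure P'] (hP : P (closedBall 0 R)ᶜ = 0) (hP' : P' (closedBall 0 R)ᶜ = 0)
    (h : Euc d → ℝ) (hh : LipschitzWith 1 h) : (∫ x, h x ∂P) - ∫ x, h x ∂P' ≤ 2 * R := by
  have hb : ∀ x, |h x - h 0| ≤ ‖x‖ := fun x => by
    have := hh.dist_le_mul x 0
    simpa [Real.dist_eq] using this
  have key : ∀ (P : Measure (Euc d)) [IsProbabilityMeasure P], P (closedBall 0 R)ᶜ = 0 → |(∫ x, h x ∂P) - h 0| ≤ R := by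
    intro P _ hP
    have hae : ∀ᵐ x ∂P, ‖h x - h 0‖ ≤ R := by
      filter_upwards [ae_ball hP] with x hx
      exact (hb x).trans hx
    have hi : Integrable (fun x => h x - h 0) P :=
      (integrable_const R).mono' (hh.continuous.sub continuous_const).aestronglyMeasurable hae
    have hi' : Integrable h P := (hi.add (integrable_const (h 0))).congr (Filter.Eventually.of_forall fun x => by simp)
    have h1 := norm_integral_le_of_norm_le (integrable_const R) hae
    rw [integral_sub hi' (integrable_const _)] at h1
    simpa using h1
  have h1 := abs_le.1 (key P hP)
  have h2 := abs_le.1 (key P' hP')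
  linarith

lemma W_bound {d : ℕ} {R : ℝ} (hR : 0 < R) {H Q : ℝ} (hH : 0 ≤ H) (hQ : 0 < Q) :
    ∃ p : ℝ, 0 < p ∧ ∀ W x : ℝ, 0 < W → W ≤ 2 * R → x = 1 / W ^ 2 →
      H * ((2 * π * (W / (16 * Q)) ^ 2) ^ ((d : ℝ) / 2))⁻¹ ≤ W * Real.exp (p * x) := by
  set x0 := 1 / (2 * R) ^ 2 with hx0
  have h0 : 0 < x0 := by positivity
  set c := (2 * π / (256 * Q ^ 2)) ^ ((d : ℝ) / 2) with hc
  have hc0 : 0 < c := by positivity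
  refine ⟨(2 * R * H * c⁻¹) / x0 + d / 2 + 1, by positivity, ?_⟩
  intro W x hW hWR hx
  have hx00 : 0 < x := by rw [hx]; positivity
  have hxx : x0 ≤ x := by rw [hx, hx0]; gcongr
  have hWx : W ^ 2 * x = 1 := by rw [hx]; field_simp
  have hxe : x ≤ Real.exp x := by linarith [Real.add_one_le_exp x]
  have e1 : ((2 * π * (W / (16 * Q)) ^ 2) ^ ((d : ℝ) / 2))⁻¹ = c⁻¹ * x ^ ((d : ℝ) / 2) := by
    rw [hc, ← Real.inv_rpow (by positivity), ← Real.inv_rpow (by positivity), ← Real.mul_rpow (by positivity) (by positivity)]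
    congr 1
    rw [hx]; field_simp; norm_num
  have e2 : x ^ ((d : ℝ) / 2) ≤ Real.exp (d / 2 * x) := by
    calc x ^ ((d : ℝ) / 2) ≤ (Real.exp x) ^ ((d : ℝ) / 2) := Real.rpow_le_rpow hx00.le hxe (by positivity)
      _ = _ := by rw [← Real.exp_mul]; congr 1; ring
  have e3 : 1 ≤ W * (2 * R * Real.exp x) := by
    calc 1 = W * (W * x) := by rw [← hWx]; ring
      _ ≤ _ := by gcongr
  have e4 := const_le_exp (c := 2 * R * H * c⁻¹) (by positivity) h0 hxx
  rw [e1]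
  calc H * (c⁻¹ * x ^ ((d : ℝ) / 2)) ≤ H * (c⁻¹ * Real.exp (d / 2 * x)) * 1 := by rw [mul_one]; gcongr
    _ ≤ H * (c⁻¹ * Real.exp (d / 2 * x)) * (W * (2 * R * Real.exp x)) := by gcongr
    _ = W * ((2 * R * H * c⁻¹) * (Real.exp (d / 2 * x) * Real.exp x)) := by ring
    _ ≤ W * (Real.exp (2 * R * H * c⁻¹ / x0 * x) * (Real.exp (d / 2 * x) * Real.exp x)) := by gcongr
    _ = _ := by rw [← Real.exp_add, ← Real.exp_add]; congr 2; ring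

lemma partW {d : ℕ} {R l L : ℝ} (hR : 0 < R) (hl : 0 < l) (hlL : l < L) :
    ∃ C Ctil : ℝ, 0 < C ∧ 0 < Ctil ∧ ∀ (P P' : Measure (Euc d)), IsProbabilityMeasure P → IsProbabilityMeasure P' →
        P (closedBall 0 R)ᶜ = 0 → P' (closedBall 0 R)ᶜ = 0 →
        ∀ A ∈ matSet d l L, ∀ B ∈ matSet d l L, 0 < W1 P P' →
        Real.exp (-(C / W1 P P' ^ 2) * Real.exp (Ctil / W1 P P' ^ 2)) ≤ ∫ x, |gaussMix P A x - gaussMix P' B x| := by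
  have hL : 0 < L := hl.trans hlL
  obtain ⟨K0, K1, hK0, hK1, hlem⟩ := lemma1 (d := d) hR hl hlL
  obtain ⟨Q, hQ⟩ : ∃ Q : ℝ, Q = (2 : ℝ) ^ ((d : ℝ) / 2) := ⟨_, rfl⟩
  have hQ0 : 0 < Q := by rw [hQ]; positivity
  obtain ⟨H, hH⟩ : ∃ H : ℝ, H = 2 * R * (volume (closedBall (0 : Euc d) (2 * R))).toReal := ⟨_, rfl⟩
  have hH0 : 0 ≤ H := by rw [hH]; positivity
  obtain ⟨p, hp, hWb⟩ := W_bound (d := d) hR hH0 hQ0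
  obtain ⟨x0, hx0⟩ : ∃ x0 : ℝ, x0 = 1 / (2 * R) ^ 2 := ⟨_, rfl⟩
  have h0 : 0 < x0 := by rw [hx0]; positivity
  obtain ⟨a, τ, ha, hτ, hnum⟩ := num_bound hK0 hK1 hL hQ0 h0 hp
  refine ⟨4 * K1 / x0, 2 * a, by positivity, by positivity, ?_⟩
  intro P P' _ _ hP hP' A hA B hB hW
  have hne : {r | ∃ h : Euc d → ℝ, LipschitzWith 1 h ∧ r = (∫ x, h x ∂P) - ∫ x, h x ∂P'}.Nonempty :=
    ⟨_, fun _ => 0, (LipschitzWith.const (0:ℝ)).weaken zero_le_one, rfl⟩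
  have hWR : W1 P P' ≤ 2 * R := csSup_le hne (by
    rintro r ⟨h, hh, rfl⟩; exact lip_diff_le P P' hP hP' h hh)
  obtain ⟨r, ⟨h, hh, rfl⟩, hr⟩ := exists_lt_of_lt_csSup hne (show W1 P P' / 2 < sSup _ by
    change W1 P P' / 2 < W1 P P'; linarith)
  generalize W1 P P' = W at *
  obtain ⟨x, hx⟩ : ∃ x : ℝ, x = 1 / W ^ 2 := ⟨_, rfl⟩
  have hx00 : 0 < x := by rw [hx]; positivity
  have hxx : x0 ≤ x := by rw [hx, hx0]; gcongr
  obtain ⟨k, hk⟩ : ∃ k : ℕ, k = ⌈Real.exp (a * x)⌉₊ := ⟨_, rfl⟩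
  have hk1 : Real.exp (a * x) ≤ k := by rw [hk]; exact Nat.le_ceil _
  have hk2 : (k : ℝ) ≤ 2 * Real.exp (a * x) := by
    have h1 : (k : ℝ) < Real.exp (a * x) + 1 := by rw [hk]; exact Nat.ceil_lt_add_one (Real.exp_pos _).le
    have h2 : 1 ≤ Real.exp (a * x) := Real.one_le_exp (by positivity)
    linarith
  have hkp : (0 : ℝ) < k := (Real.exp_pos _).trans_le hk1
  have hkn : 1 ≤ k := by exact_mod_cast hkp
  have hfin : Real.exp (-(K1 * (k * Real.log (k + 1)))) ≤ ∫ x, |gaussMix P A x - gaussMix P' B x| := by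
    by_contra hcon
    push Not at hcon
    obtain ⟨V, hV⟩ : ∃ V : ℝ, V = ∫ x, |gaussMix P A x - gaussMix P' B x| := ⟨_, rfl⟩
    have hV0 : 0 ≤ V := by rw [hV]; exact integral_nonneg fun x => abs_nonneg _
    have hu : ∀ v : Euc d, ‖v‖ = 1 → |quadForm (A - B) v| ≤ K0 / k := by
      intro v hv
      by_contra hc
      push Not at hc
      rw [quadForm_sub'] at hc
      rw [div_lt_iff₀ hkp] at hc
      exact absurd (hlem P P' ‹_› ‹_› hP hP' A hA B hB v hv k hkn (by linarith)) (not_le.2 hcon)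
    have hη : ∀ t : Euc d, |quadForm A t - quadForm B t| ≤ K0 / k * ‖t‖ ^ 2 := fun t => by
      have := quad_of_unit hu t
      rwa [quadForm_sub'] at this
    rw [← hV] at hcon
    have hn := hnum x hxx k hk1 V hcon.le
    have hη0 : 0 < K0 / k := by positivity
    generalize K0 / (k : ℝ) = η at *
    obtain ⟨F, hF⟩ : ∃ F : ℝ, F = V * Real.exp (L * (τ * x ^ 2) / 2) + (η * (τ * x ^ 2)) * Real.exp (η * (τ * x ^ 2)) := ⟨_, rfl⟩
    obtain ⟨E, hE⟩ : ∃ E : ℝ, E = 2 * Real.exp (-(τ * x / (1024 * Q ^ 2))) := ⟨_, rfl⟩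
    have hF0 : 0 ≤ F := by rw [hF]; positivity
    have hE0 : 0 ≤ E := by rw [hE]; positivity
    obtain ⟨σ, hσ⟩ : ∃ σ : ℝ, σ = W / (16 * Q) := ⟨_, rfl⟩
    have hσ0 : 0 < σ := by rw [hσ]; positivity
    have hchar : ∀ t : Euc d, ‖charFun P t - charFun P' t‖ ≤ F + E * Real.exp (σ ^ 2 / 4 * ‖t‖ ^ 2) := by
      intro t
      rcases le_or_gt (‖t‖ ^ 2) (τ * x ^ 2) with ht | ht
      · have h1 := char_diff hl P P' hA hB hV.ge hη t
        have h2 : V * Real.exp (L * ‖t‖ ^ 2 / 2) + η * ‖t‖ ^ 2 * Real.exp (η * ‖t‖ ^ 2) ≤ F := by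
          rw [hF]; gcongr
        have : 0 ≤ E * Real.exp (σ ^ 2 / 4 * ‖t‖ ^ 2) := by positivity
        linarith
      · have h1 : ‖charFun P t - charFun P' t‖ ≤ 1 + 1 :=
          (norm_sub_le _ _).trans (add_le_add (norm_charFun_le_one t) (norm_charFun_le_one t))
        have h2 : 2 ≤ E * Real.exp (σ ^ 2 / 4 * ‖t‖ ^ 2) := by
          have h3 : τ * x / (1024 * Q ^ 2) ≤ σ ^ 2 / 4 * ‖t‖ ^ 2 := by
            calc τ * x / (1024 * Q ^ 2) = σ ^ 2 / 4 * (τ * x ^ 2) := by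
                  rw [hσ, hx]; field_simp; norm_num
              _ ≤ _ := by gcongr
          rw [hE, mul_assoc, ← Real.exp_add]
          have : 1 ≤ Real.exp (-(τ * x / (1024 * Q ^ 2)) + σ ^ 2 / 4 * ‖t‖ ^ 2) := Real.one_le_exp (by linarith)
          linarith
        linarith
    have hs := smooth_W hR hσ0 P P' hP hP' hchar h hh
    rw [← hQ, ← hH] at hs
    have hb := hWb W x hW hWR hx
    rw [← hσ] at hb
    rw [← hF, ← hE] at hn
    have hmul : H * ((2 * π * σ ^ 2) ^ ((d : ℝ) / 2))⁻¹ * (F + Q * E) ≤ W * Real.exp (p * x) * (Real.exp (-(p * x)) / 4) := by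
      have : 0 ≤ F + Q * E := by positivity
      gcongr
    have e1 : W * Real.exp (p * x) * (Real.exp (-(p * x)) / 4) = W / 4 := by
      have : Real.exp (p * x) * Real.exp (-(p * x)) = 1 := by rw [← Real.exp_add]; simp
      linear_combination W / 4 * this
    have e2 : 2 * Q * σ = W / 8 := by rw [hσ]; field_simp; norm_num
    rw [e1] at hmul
    rw [e2] at hs
    linarith
  refine le_trans (Real.exp_le_exp.2 ?_) hfin
  have hlog : Real.log (k + 1) ≤ k := by
    have := Real.log_le_sub_one_of_pos (show (0:ℝ) < k + 1 by positivity)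
    linarith
  have h1 : K1 * (k * Real.log (k + 1)) ≤ K1 * (2 * Real.exp (a * x) * (2 * Real.exp (a * x))) := by
    have : 0 ≤ Real.log ((k : ℝ) + 1) := Real.log_nonneg (by linarith)
    gcongr
    exact hlog.trans hk2
  have h2 : K1 * (2 * Real.exp (a * x) * (2 * Real.exp (a * x))) = 4 * K1 * Real.exp (2 * a * x) := by
    rw [show 2 * a * x = a * x + a * x by ring, Real.exp_add]; ring
  have h3 : 4 * K1 * Real.exp (2 * a * x) ≤ 4 * K1 / x0 * x * Real.exp (2 * a * x) := by
    have : 4 * K1 ≤ 4 * K1 / x0 * x := by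
      rw [div_mul_eq_mul_div, le_div_iff₀ h0]; gcongr
    gcongr
  have e1 : 4 * K1 / x0 / W ^ 2 = 4 * K1 / x0 * x := by rw [hx]; ring
  have e2 : 2 * a / W ^ 2 = 2 * a * x := by rw [hx]; ring
  rw [e1, e2]
  linarith

/-- Theorem 4.1 (inverse bound for homoscedastic Gaussian location-scale mixtures). -/
theorem gaussian_inverse_bound
    (d : ℕ) (hd : 1 ≤ d) (R lmin lmax : ℝ) (hR : 0 < R) (hlmin : 0 < lmin) (hl : lmin < lmax) :
    ∃ M C Ctil C' : ℝ, 0 < M ∧ 0 < C ∧ 0 < Ctil ∧ 0 < C' ∧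
      ∀ (P P' : Measure (Euc d)), IsProbabilityMeasure P → IsProbabilityMeasure P' →
        P (closedBall 0 R)ᶜ = 0 → P' (closedBall 0 R)ᶜ = 0 →
        ∀ A ∈ matSet d lmin lmax, ∀ B ∈ matSet d lmin lmax,
          C' * ((if 0 < W1 P P' then
                  Real.exp (-(C / W1 P P' ^ 2) * Real.exp (Ctil / W1 P P' ^ 2))
                else 0) +
               (if A ≠ B then
                  Real.exp (-(M * Real.log (1 / opNorm (A - B)) / opNorm (A - B)))
                else 0)) ≤
          ∫ x, |gaussMix P A x - gaussMix P' B x| := by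
  obtain ⟨M, c, hM, hc, hS⟩ := partSigma (d := d) hR hlmin hl
  obtain ⟨C, Ctil, hC, hCt, hWW⟩ := partW (d := d) hR hlmin hl
  refine ⟨M, C, Ctil, min c 1 / 2, hM, hC, hCt, by positivity, ?_⟩
  intro P P' hPp hPp' hP hP' A hA B hB
  have hV0 : 0 ≤ ∫ x, |gaussMix P A x - gaussMix P' B x| := integral_nonneg fun x => abs_nonneg _
  have hm0 : 0 < min c 1 := by positivity
  have h1 : min c 1 * (if 0 < W1 P P' then
      Real.exp (-(C / W1 P P' ^ 2) * Real.exp (Ctil / W1 P P' ^ 2)) else 0) ≤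
      ∫ x, |gaussMix P A x - gaussMix P' B x| := by
    split_ifs with hW
    · exact (mul_le_of_le_one_left (Real.exp_pos _).le (min_le_right _ _)).trans
        (hWW P P' hPp hPp' hP hP' A hA B hB hW)
    · simpa using hV0
  have h2 : min c 1 * (if A ≠ B then
      Real.exp (-(M * Real.log (1 / opNorm (A - B)) / opNorm (A - B))) else 0) ≤
      ∫ x, |gaussMix P A x - gaussMix P' B x| := by
    by_cases hAB : A ≠ B
    · rw [if_pos hAB]
      exact (mul_le_mul_of_nonneg_right (min_le_left _ _) (Real.exp_pos _).le).trans
        (hS P P' hPp hPp' hP hP' A hA B hB hAB)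
    · rw [if_neg hAB]; simpa using hV0
  linarith
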